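/- arXiv:1703.07170 — 2 statements merged into one kernel-verified Lean document; each statement's English description precedes it below -/
import Mathlib

section
/- Let x be a chain-point for the chain V_0 ⊊ V_1 ⊊ … ⊊ V_k and let λ := 2 − max_{i=0,…,k} x(δ(V_i)). Then there exist ε with 0 < ε ≤ λ, y ∈ Sp_𝒞(G), and x' ∈ Sp(G) such that x = ε·y + (1−ε)·x'. -/
open Finset
open scoped Classical

variable {V : Type*} [Fintype V]

/-- The set of edges of `G` with one endpoint in `S₁` and the other in `S₂`. -/
noncomputable def cutBetween (G : SimpleGraph V) (S₁ S₂ : Finset V) : Finset (Sym2 V) :=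
  G.edgeFinset.filter (fun e => ∃ u v, e = s(u, v) ∧ u ∈ S₁ ∧ v ∈ S₂)

/-- The cut `δ(S)`: edges of `G` with exactly one endpoint in `S`. -/
noncomputable def cut (G : SimpleGraph V) (S : Finset V) : Finset (Sym2 V) :=
  cutBetween G S Sᶜ

/-- `E(S)`: edges of `G` with both endpoints in `S`. -/
noncomputable def inducedEdges (G : SimpleGraph V) (S : Finset V) : Finset (Sym2 V) :=
  G.edgeFinset.filter (fun e => ∀ v ∈ e, v ∈ S)

/-- `T` is the edge set of a spanning tree of `G`. -/
def IsSpanningTree (G : SimpleGraph V) (T : Finset (Sym2 V)) : Prop :=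
  (T : Set (Sym2 V)) ⊆ G.edgeSet ∧ (SimpleGraph.fromEdgeSet (T : Set (Sym2 V))).IsTree

/-- Characteristic vector of a set of edges. -/
noncomputable def chi (T : Finset (Sym2 V)) : Sym2 V → ℝ :=
  fun e => if e ∈ T then 1 else 0

/-- The spanning tree polytope `Sp(G)`. -/
noncomputable def spanningTreePolytope (G : SimpleGraph V) : Set (Sym2 V → ℝ) :=
  convexHull ℝ {x | ∃ T : Finset (Sym2 V), IsSpanningTree G T ∧ x = chi T}

/-- The level sets `L_i = V_i \ V_{i-1}` of a chain `V_0 ⊊ … ⊊ V_k` (with `V_{-1} = ∅`,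
`V_{k+1} = V`). -/
noncomputable def level (Vc : ℕ → Finset V) (k : ℕ) : ℕ → Finset V :=
  fun i => if i = 0 then Vc 0 else if i ≤ k then Vc i \ Vc (i - 1) else Finset.univ \ Vc k

/-- `x` is a chain-point for the chain `V_0 ⊊ … ⊊ V_k`. -/
def IsChainPoint (G : SimpleGraph V) (Vc : ℕ → Finset V) (k : ℕ) (x : Sym2 V → ℝ) : Prop :=
  x ∈ spanningTreePolytope G ∧
  (∑ e ∈ cut G (Vc 0), x e) = 1 ∧
  (∑ e ∈ cut G (Vc k), x e) = 1 ∧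
  (∀ i, 1 ≤ i → i ≤ k - 1 → (∑ e ∈ cut G (Vc i), x e) < 2) ∧
  (∀ i, 1 ≤ i → i ≤ k →
    (∑ v ∈ level Vc k i, ∑ e ∈ cut G {v}, x e) = 2 * ((level Vc k i).card : ℝ))

/-- A Gao-tree for the chain `V_0 ⊊ … ⊊ V_k`: a spanning tree meeting each cut `δ(V_i)`
in exactly one edge. -/
def IsGaoTree (G : SimpleGraph V) (Vc : ℕ → Finset V) (k : ℕ) (T : Finset (Sym2 V)) : Prop :=
  IsSpanningTree G T ∧ ∀ i ≤ k, (T ∩ cut G (Vc i)).card = 1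

/-- A Gao-tree for the subchain of `V_0 ⊊ … ⊊ V_k` given by the index set `I`. -/
def IsGaoTreeOn (G : SimpleGraph V) (Vc : ℕ → Finset V) (I : Finset ℕ)
    (T : Finset (Sym2 V)) : Prop :=
  IsSpanningTree G T ∧ ∀ i ∈ I, (T ∩ cut G (Vc i)).card = 1

/-- `Sp_𝒞(G)`: the convex hull of characteristic vectors of Gao-trees. -/
noncomputable def gaoPolytope (G : SimpleGraph V) (Vc : ℕ → Finset V) (k : ℕ) :
    Set (Sym2 V → ℝ) :=
  convexHull ℝ {x | ∃ T : Finset (Sym2 V), IsGaoTree G Vc k T ∧ x = chi T}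

/-- `F` is the edge set of a spanning tree of the induced subgraph `G(U)`. -/
def IsSpanningTreeOfInduced (G : SimpleGraph V) (U : Finset V) (F : Finset (Sym2 V)) : Prop :=
  (F : Set (Sym2 V)) ⊆ G.edgeSet ∧ (∀ e ∈ F, ∀ v ∈ e, v ∈ U) ∧
  F.card = U.card - 1 ∧
  ∀ u ∈ U, ∀ v ∈ U, (SimpleGraph.fromEdgeSet (F : Set (Sym2 V))).Reachable u v

/-- The rank of `X` in the cycle matroid of `G`. -/
noncomputable def cycleRank (G : SimpleGraph V) (X : Finset (Sym2 V)) : ℕ :=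
  (G.edgeFinset.powerset.filter (fun T => IsSpanningTree G T)).sup (fun T => (T ∩ X).card)

/-- The rank of `X` in the matroid whose bases are the Gao-trees. -/
noncomputable def gaoRank (G : SimpleGraph V) (Vc : ℕ → Finset V) (k : ℕ)
    (X : Finset (Sym2 V)) : ℕ :=
  (G.edgeFinset.powerset.filter (fun T => IsGaoTree G Vc k T)).sup (fun T => (T ∩ X).card)

/-- `x` is a solution of the `s`–`t` path TSP subtour elimination LP. -/
def IsSubtourLPSolution (G : SimpleGraph V) (s t : V) (x : Sym2 V → ℝ) : Prop :=
  x ∈ spanningTreePolytope G ∧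
  (∀ v, v ≠ s → v ≠ t → (∑ e ∈ cut G {v}, x e) = 2) ∧
  (∑ e ∈ cut G {s}, x e) = 1 ∧ (∑ e ∈ cut G {t}, x e) = 1

/-- Rank function of a matroid on a finite ground set, as a function on finsets. -/
noncomputable def mrank {E : Type*} [Fintype E] (M : Matroid E) (X : Finset E) : ℕ :=
  (X.powerset.filter (fun I : Finset E => M.Indep (I : Set E))).sup Finset.card

/-- Convex hull of characteristic vectors of independent sets of a matroid. -/
noncomputable def indepPolytope {E : Type*} [Fintype E] (M : Matroid E) : Set (E → ℝ) :=
  convexHull ℝ {x | ∃ I : Finset E, M.Indep (I : Set E) ∧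
    x = fun e => if e ∈ I then (1 : ℝ) else 0}

/-- The graph on `V` whose edges are the non-loops in `T`. -/
abbrev edgeGraph (T : Finset (Sym2 V)) : SimpleGraph V :=
  SimpleGraph.fromEdgeSet (T : Set (Sym2 V))

theorem edgeFinset_edgeGraph {G : SimpleGraph V} {T : Finset (Sym2 V)}
    (hT : (T : Set (Sym2 V)) ⊆ G.edgeSet) {_ : Fintype (edgeGraph T).edgeSet} :
    (edgeGraph T).edgeFinset = T := by
  ext e
  simp only [SimpleGraph.mem_edgeFinset, SimpleGraph.edgeSet_fromEdgeSet, Set.mem_sdiff, mem_coe]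
  exact ⟨fun h => h.1, fun h => ⟨h, fun h' => G.not_isDiag_of_mem_edgeSet (hT h) h'⟩⟩

theorem edgeGraph_adj {G : SimpleGraph V} {T : Finset (Sym2 V)}
    (hT : (T : Set (Sym2 V)) ⊆ G.edgeSet) {u v : V} :
    (edgeGraph T).Adj u v ↔ s(u, v) ∈ T := by
  rw [← SimpleGraph.mem_edgeSet, ← SimpleGraph.mem_edgeFinset, edgeFinset_edgeGraph hT]

theorem IsSpanningTree.card_add_one {G : SimpleGraph V} {T : Finset (Sym2 V)}
    (hT : IsSpanningTree G T) : #T + 1 = Fintype.card V := by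
  have := hT.2.card_edgeFinset
  rwa [edgeFinset_edgeGraph hT.1] at this

theorem card_filter_forall_mem_eq_card_induce {G : SimpleGraph V} {T : Finset (Sym2 V)}
    (hT : (T : Set (Sym2 V)) ⊆ G.edgeSet) (A : Finset V) :
    #{e ∈ T | ∀ v ∈ e, v ∈ A} = #((edgeGraph T).induce (A : Set V)).edgeFinset := by
  refine Eq.trans ?_ ((SimpleGraph.card_filter_edgeFinset_toFinset_subset (G := edgeGraph T) A).trans
    (by congr!))
  rw [edgeFinset_edgeGraph hT]
  congr 1
  ext e
  simp [Finset.subset_iff]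

theorem IsSpanningTree.card_filter_forall_mem_add_one_le {G : SimpleGraph V}
    {T : Finset (Sym2 V)} (hT : IsSpanningTree G T) {A : Finset V} (hA : A.Nonempty) :
    #{e ∈ T | ∀ v ∈ e, v ∈ A} + 1 ≤ #A := by
  rw [card_filter_forall_mem_eq_card_induce hT.1]
  have hne : Nonempty (A : Set V) := hA.coe_sort
  obtain ⟨F, hF, -, hFt⟩ := (SimpleGraph.connected_top (V := (A : Set V))
    ).exists_isTree_le_of_le_of_isAcyclic le_top (hT.2.isAcyclic.induce (A : Set V))
  have h1 := hFt.card_edgeFinset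
  have h2 : #((edgeGraph T).induce (A : Set V)).edgeFinset ≤ #F.edgeFinset :=
    card_le_card (SimpleGraph.edgeFinset_mono hF)
  have h3 : Fintype.card (A : Set V) = #A := by simp
  omega

theorem IsSpanningTree.exchange {G : SimpleGraph V} {T : Finset (Sym2 V)}
    (hT : IsSpanningTree G T) {f : Sym2 V} (hf : f ∈ T) {u v : V} (huv : G.Adj u v)
    (hnr : ¬ (edgeGraph (T.erase f)).Reachable u v) :
    s(u, v) ∉ T.erase f ∧ IsSpanningTree G (insert s(u, v) (T.erase f)) := by
  have herase : ((T.erase f : Finset _) : Set (Sym2 V)) ⊆ G.edgeSet :=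
    fun e he => hT.1 (mem_of_mem_erase (mem_coe.1 he))
  have hnot : s(u, v) ∉ T.erase f := fun h =>
    hnr ((edgeGraph_adj herase).2 h).reachable
  have hsub : ((insert s(u, v) (T.erase f) : Finset _) : Set (Sym2 V)) ⊆ G.edgeSet := by
    rw [coe_insert]
    exact Set.insert_subset huv herase
  refine ⟨hnot, hsub, ?_⟩
  have hac : (edgeGraph (T.erase f)).IsAcyclic :=
    hT.2.isAcyclic.anti (SimpleGraph.fromEdgeSet_mono (by simp))
  have hac' : (edgeGraph (insert s(u, v) (T.erase f))).IsAcyclic := by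
    convert hac.sup_edge_of_not_reachable hnr using 1
    rw [edgeGraph, coe_insert, SimpleGraph.edge, ← SimpleGraph.fromEdgeSet_union, Set.union_comm]
    rfl
  have hne : Nonempty V := ⟨u⟩
  obtain ⟨F, hF, -, hFt⟩ := (SimpleGraph.connected_top (V := V)
    ).exists_isTree_le_of_le_of_isAcyclic le_top hac'
  have h1 := hFt.card_edgeFinset
  have h2 := SimpleGraph.edgeFinset_mono hF
  have h4 : #(insert s(u, v) (T.erase f)) = #T := by
    rw [card_insert_of_notMem hnot, card_erase_add_one hf]
  have h5 := hT.card_add_one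
  have h6 : (edgeGraph (insert s(u, v) (T.erase f))).edgeFinset = F.edgeFinset := by
    refine eq_of_subset_of_card_le h2 ?_
    rw [edgeFinset_edgeGraph hsub, h4]
    omega
  have h7 : edgeGraph (insert s(u, v) (T.erase f)) = F := SimpleGraph.edgeFinset_inj.1 h6
  exact (congrArg SimpleGraph.IsTree h7).mpr hFt

theorem IsSpanningTree.not_reachable_erase {G : SimpleGraph V} {T : Finset (Sym2 V)}
    (hT : IsSpanningTree G T) {a b : V} (hf : s(a, b) ∈ T) :
    ¬ (edgeGraph (T.erase s(a, b))).Reachable a b := by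
  have hadj : (edgeGraph T).Adj a b := (edgeGraph_adj hT.1).2 hf
  have h := SimpleGraph.isAcyclic_iff_forall_isBridge.1 hT.2.isAcyclic (e := s(a, b)) hadj
  rw [SimpleGraph.isBridge_iff] at h
  convert h using 2
  simp [edgeGraph, SimpleGraph.deleteEdges]

/-- `T` minimizes the total cost `c` among the spanning trees of `G`. -/
def IsMinCostTree (G : SimpleGraph V) (c : Sym2 V → ℝ) (T : Finset (Sym2 V)) : Prop :=
  IsSpanningTree G T ∧ ∀ S, IsSpanningTree G S → ∑ e ∈ T, c e ≤ ∑ e ∈ S, c e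

theorem IsMinCostTree.cost_le {G : SimpleGraph V} {c : Sym2 V → ℝ} {T : Finset (Sym2 V)}
    (hT : IsMinCostTree G c T) {f : Sym2 V} (hf : f ∈ T) {u v : V} (huv : G.Adj u v)
    (hnr : ¬ (edgeGraph (T.erase f)).Reachable u v) : c f ≤ c s(u, v) := by
  obtain ⟨hn, hS⟩ := hT.1.exchange hf huv hnr
  have := hT.2 _ hS
  rw [sum_insert hn, ← add_sum_erase _ _ hf] at this
  linarith

/-- The subgraph of `G` formed by the edges of cost at most `t`. -/
noncomputable abbrev thresholdGraph (G : SimpleGraph V) (c : Sym2 V → ℝ) (t : ℝ) : SimpleGraph V :=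
  edgeGraph {e ∈ G.edgeFinset | c e ≤ t}

theorem thresholdGraph_adj {G : SimpleGraph V} {c : Sym2 V → ℝ} {t : ℝ} {u v : V} :
    (thresholdGraph G c t).Adj u v ↔ G.Adj u v ∧ c s(u, v) ≤ t := by
  rw [thresholdGraph, edgeGraph_adj (G := G) (by intro e; simp; tauto)]
  simp

theorem IsMinCostTree.reachable_of_adj {G : SimpleGraph V} {c : Sym2 V → ℝ}
    {T : Finset (Sym2 V)} (hT : IsMinCostTree G c T) {t : ℝ} {u v : V} (huv : G.Adj u v)
    (hc : c s(u, v) ≤ t) : (edgeGraph {e ∈ T | c e ≤ t}).Reachable u v := by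
  by_contra hn
  obtain ⟨p, hp⟩ := (hT.1.2.connected u v).exists_isPath
  obtain ⟨d, hd, hd1, hd2⟩ := p.exists_boundary_dart
    {w | (edgeGraph {e ∈ T | c e ≤ t}).Reachable u w} (SimpleGraph.Reachable.refl _) hn
  have hdT : s(d.fst, d.snd) ∈ T := (edgeGraph_adj hT.1.1).1 d.adj
  have hdt : t < c s(d.fst, d.snd) := by
    by_contra! hle
    refine hd2 (SimpleGraph.Reachable.trans hd1 (SimpleGraph.Adj.reachable ?_))
    rw [edgeGraph_adj (G := G) (fun e he => hT.1.1 (mem_of_mem_filter e (mem_coe.1 he)))]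
    exact mem_filter.2 ⟨hdT, hle⟩
  have hnr : ¬ (edgeGraph (T.erase s(d.fst, d.snd))).Reachable u v := by
    intro h
    have h' : ((edgeGraph T).deleteEdges {s(d.fst, d.snd)}).Reachable u v := by
      convert h using 1
      simp [edgeGraph, SimpleGraph.deleteEdges]
    obtain ⟨q, hq⟩ := SimpleGraph.reachable_deleteEdges_iff_exists_walk.1 h'
    have heq := (hT.1.2.isAcyclic.subsingleton_path u v).elim ⟨p, hp⟩ q.toPath
    have hpe : s(d.fst, d.snd) ∈ p.edges := List.mem_map.2 ⟨d, hd, rfl⟩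
    have : p = (q.toPath : (edgeGraph T).Walk u v) := congrArg Subtype.val heq
    rw [this] at hpe
    exact hq (q.edges_toPath_subset_edges hpe)
  exact absurd (hT.cost_le hdT huv hnr) (by linarith)

/-- The vertices joined to `a` by edges of cost at most `t`. -/
noncomputable def thresholdComponent (G : SimpleGraph V) (c : Sym2 V → ℝ) (t : ℝ) (a : V) : Finset V :=
  {v | (thresholdGraph G c t).Reachable a v}

theorem mem_thresholdComponent {G : SimpleGraph V} {c : Sym2 V → ℝ} {t : ℝ} {a v : V} :
    v ∈ thresholdComponent G c t a ↔ (thresholdGraph G c t).Reachable a v := by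
  simp [thresholdComponent]

theorem IsMinCostTree.card_thresholdComponent_le {G : SimpleGraph V} {c : Sym2 V → ℝ}
    {T : Finset (Sym2 V)} (hT : IsMinCostTree G c T) (t : ℝ) (a : V) :
    #(thresholdComponent G c t a) ≤
      #{e ∈ T | c e ≤ t ∧ ∀ v ∈ e, v ∈ thresholdComponent G c t a} + 1 := by
  set H := edgeGraph {e ∈ T | c e ≤ t} with hH
  have hsub : (({e ∈ T | c e ≤ t} : Finset _) : Set (Sym2 V)) ⊆ G.edgeSet :=
    fun e he => hT.1.1 (mem_of_mem_filter e (mem_coe.1 he))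
  have hreach : ∀ v, (thresholdGraph G c t).Reachable a v ↔ H.Reachable a v := by
    intro v
    constructor
    · rintro ⟨p⟩
      induction p with
      | nil => exact SimpleGraph.Reachable.refl _
      | cons h p ih =>
        obtain ⟨h1, h2⟩ := thresholdGraph_adj.1 h
        exact (hT.reachable_of_adj h1 h2).trans ih
    · refine fun h => h.mono (SimpleGraph.fromEdgeSet_mono ?_)
      intro e he
      have := hsub he
      simp_all
  have hset : ((thresholdComponent G c t a : Finset V) : Set V)
      = (H.connectedComponentMk a).supp := by
    ext v
    rw [mem_coe, mem_thresholdComponent, hreach, SimpleGraph.ConnectedComponent.mem_supp_iff,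
      SimpleGraph.ConnectedComponent.eq]
    exact SimpleGraph.reachable_comm
  have hconn : (H.induce ((thresholdComponent G c t a : Finset V) : Set V)).Connected := by
    rw [hset]
    exact (H.connectedComponentMk a).connected_toSimpleGraph
  have h1 := hconn.card_vert_le_card_edgeSet_add_one
  rw [Nat.card_eq_fintype_card, Nat.card_eq_fintype_card, ← SimpleGraph.edgeFinset_card,
    ← card_filter_forall_mem_eq_card_induce hsub, filter_filter] at h1
  simpa using h1

theorem sum_chi (T F : Finset (Sym2 V)) : ∑ e ∈ F, chi T e = #(F ∩ T) := by
  simp [chi, Finset.sum_ite_mem]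

theorem sum_chi_mul (T : Finset (Sym2 V)) (c : Sym2 V → ℝ) :
    ∑ e, chi T e * c e = ∑ e ∈ T, c e := by
  simp [chi, ite_mul, Finset.sum_ite_mem]

theorem le_sum_of_mem_spanningTreePolytope {G : SimpleGraph V} {x : Sym2 V → ℝ}
    (hx : x ∈ spanningTreePolytope G) {c : Sym2 V → ℝ} {F : Finset (Sym2 V)} {r : ℝ}
    (hc : ∀ T, IsSpanningTree G T → ∑ e, x e * c e ≤ ∑ e ∈ T, c e)
    (hF : ∀ T, IsMinCostTree G c T → r ≤ #(F ∩ T)) : r ≤ ∑ e ∈ F, x e := by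
  set m := ∑ e, x e * c e with hm
  have hconv : Convex ℝ
      {z : Sym2 V → ℝ | m ≤ ∑ e, z e * c e ∧ (∑ e, z e * c e = m → r ≤ ∑ e ∈ F, z e)} := by
    rw [convex_iff_forall_pos]
    rintro y ⟨hy1, hy2⟩ z ⟨hz1, hz2⟩ a b ha hb hab
    have h1 : ∑ e, (a • y + b • z) e * c e = a * ∑ e, y e * c e + b * ∑ e, z e * c e := by
      rw [mul_sum, mul_sum, ← sum_add_distrib]
      exact sum_congr rfl fun e _ => by simp; ring
    have h2 : ∑ e ∈ F, (a • y + b • z) e = a * ∑ e ∈ F, y e + b * ∑ e ∈ F, z e := by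
      rw [mul_sum, mul_sum, ← sum_add_distrib]
      exact sum_congr rfl fun e _ => by simp
    have hbm : a * m + b * m = m := by rw [← add_mul, hab, one_mul]
    simp only [Set.mem_ofPred_eq]
    rw [h1, h2]
    refine ⟨by nlinarith, fun h => ?_⟩
    have hya := mul_le_mul_of_nonneg_left hy1 ha.le
    have hzb := mul_le_mul_of_nonneg_left hz1 hb.le
    have hy3 := hy2 (mul_left_cancel₀ ha.ne' (by linarith))
    have hz3 := hz2 (mul_left_cancel₀ hb.ne' (by linarith))
    have hbr : a * r + b * r = r := by rw [← add_mul, hab, one_mul]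
    nlinarith
  refine (convexHull_min ?_ hconv hx).2 rfl
  rintro _ ⟨T, hT, rfl⟩
  simp only [Set.mem_ofPred_eq, sum_chi_mul, sum_chi]
  exact ⟨hc T hT, fun h => hF T ⟨hT, fun S hS => h.le.trans (hc S hS)⟩⟩

theorem sum_le_of_mem_spanningTreePolytope {G : SimpleGraph V} {x : Sym2 V → ℝ}
    (hx : x ∈ spanningTreePolytope G) {F : Finset (Sym2 V)} {r : ℝ}
    (hF : ∀ T, IsSpanningTree G T → (#(F ∩ T) : ℝ) ≤ r) : ∑ e ∈ F, x e ≤ r := by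
  have hlin : IsLinearMap ℝ fun z : Sym2 V → ℝ => ∑ e ∈ F, z e :=
    ⟨fun y z => by simp [sum_add_distrib], fun a y => by simp [mul_sum]⟩
  refine convexHull_min ?_ (convex_halfSpace_le hlin r) hx
  rintro _ ⟨T, hT, rfl⟩
  simpa only [Set.mem_ofPred_eq, sum_chi] using hF T hT

theorem nonneg_of_mem_spanningTreePolytope {G : SimpleGraph V} {x : Sym2 V → ℝ}
    (hx : x ∈ spanningTreePolytope G) (e : Sym2 V) : 0 ≤ x e := by
  have := le_sum_of_mem_spanningTreePolytope hx (c := 0) (F := {e}) (r := 0) (by simp)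
    fun T _ => by positivity
  simpa using this

/-- A point of the convex hull of a finite set `S` admits a supporting functional whose minimum
over `S` is attained exactly at the points of `S` that carry positive weight in some convex
representation of `x`. -/
theorem exists_supporting_functional {E : Type*} [NormedAddCommGroup E] [NormedSpace ℝ E]
    [FiniteDimensional ℝ E] {S : Set E} (hS : S.Finite) {x : E} (hx : x ∈ convexHull ℝ S) :
    ∃ f : StrongDual ℝ E, (∀ z ∈ S, f x ≤ f z) ∧ ∀ z ∈ S, f z = f x →
      ∃ ε : ℝ, 0 < ε ∧ ε < 1 ∧ ∃ x' ∈ convexHull ℝ S, x = ε • z + (1 - ε) • x' := by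
  set P := convexHull ℝ S with hP
  have hPc : Convex ℝ P := convex_convexHull ℝ S
  let K : E → Prop := fun v => ∃ δ : ℝ, 0 < δ ∧ x + δ • v ∈ P
  have hshrink : ∀ {v : E} {δ η : ℝ}, 0 < δ → x + δ • v ∈ P → 0 ≤ η → η ≤ δ →
      x + η • v ∈ P := by
    intro v δ η hδ h hη hle
    have := hPc hx h (a := 1 - η / δ) (b := η / δ)
      (by rw [sub_nonneg, div_le_one hδ]; exact hle) (by positivity) (by ring)
    convert this using 1
    rw [smul_add, smul_smul, div_mul_cancel₀ _ hδ.ne', sub_smul, one_smul]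
    abel
  have hadd : ∀ {v w : E}, K v → K w → K (v + w) := by
    rintro v w ⟨δ, hδ, hv⟩ ⟨η, hη, hw⟩
    have hm : 0 < min δ η := lt_min hδ hη
    refine ⟨min δ η / 2, by positivity, ?_⟩
    have h1 := hshrink hδ hv hm.le (min_le_left _ _)
    have h2 := hshrink hη hw hm.le (min_le_right _ _)
    have := hPc h1 h2 (a := 1 / 2) (b := 1 / 2) (by norm_num) (by norm_num) (by norm_num)
    convert this using 1
    module
  have hsmul : ∀ {v : E} {a : ℝ}, 0 < a → K v → K (a • v) := by
    rintro v a ha ⟨δ, hδ, hv⟩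
    refine ⟨δ / a, by positivity, ?_⟩
    rwa [smul_smul, div_mul_cancel₀ _ ha.ne']
  have hsub : ∀ {z : E}, z ∈ P → K (z - x) := fun {z} hz => ⟨1, one_pos, by simpa using hz⟩
  have hzero : K 0 := ⟨1, one_pos, by simpa using hx⟩
  let L : Submodule ℝ E :=
    { carrier := {v | K v ∧ K (-v)}
      add_mem' := by
        rintro v w ⟨hv, hv'⟩ ⟨hw, hw'⟩
        refine ⟨hadd hv hw, ?_⟩
        rw [neg_add]
        exact hadd hv' hw'
      zero_mem' := ⟨hzero, by rwa [neg_zero]⟩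
      smul_mem' := by
        rintro a v ⟨hv, hv'⟩
        rcases lt_trichotomy a 0 with ha | rfl | ha
        · refine ⟨?_, ?_⟩
          · have := hsmul (neg_pos.2 ha) hv'
            rwa [smul_neg, neg_smul, neg_neg] at this
          · have := hsmul (neg_pos.2 ha) hv
            rwa [neg_smul] at this
        · simpa using hzero
        · refine ⟨hsmul ha hv, ?_⟩
          rw [← smul_neg]
          exact hsmul ha hv' }
  have hN : Convex ℝ {z | z ∈ P ∧ ¬ K (x - z)} := by
    rw [convex_iff_forall_pos]
    rintro y ⟨hy, hyK⟩ z ⟨hz, -⟩ a b ha hb hab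
    refine ⟨hPc hy hz ha.le hb.le hab, fun h => hyK ?_⟩
    have h2 := hsmul (inv_pos.2 ha) (hadd h (hsmul hb (hsub hz)))
    convert h2 using 1
    have hb' : b = 1 - a := by linarith
    subst hb'
    rw [show x - (a • y + (1 - a) • z) + (1 - a) • (z - x) = a • (x - y) by module,
      smul_smul, inv_mul_cancel₀ ha.ne', one_smul]
  let S₀ : Set E := {z ∈ S | ¬ K (x - z)}
  have hS₀ : convexHull ℝ S₀ ⊆ {z | z ∈ P ∧ ¬ K (x - z)} :=
    convexHull_min (fun z hz => ⟨subset_convexHull ℝ S hz.1, hz.2⟩) hN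
  have hLc : Convex ℝ {y | y - x ∈ L} := by
    have := (L.convex).translate_preimage_left (-x)
    convert this using 1
    ext y
    simp [sub_eq_add_neg]
  have hLcl : IsClosed {y | y - x ∈ L} :=
    (L.closed_of_finiteDimensional).preimage (continuous_id.sub continuous_const)
  have hdisj : Disjoint (convexHull ℝ S₀) {y | y - x ∈ L} := by
    rw [Set.disjoint_left]
    intro y hy hyL
    refine (hS₀ hy).2 ?_
    have := (show K (y - x) ∧ K (-(y - x)) from hyL).2
    rwa [neg_sub] at this
  obtain ⟨f, u, v, hfu, huv, hfv⟩ := geometric_hahn_banach_compact_closed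
    (convex_convexHull ℝ S₀) ((hS.subset (Set.sep_subset _ _)).isCompact_convexHull (𝕜 := ℝ))
    hLc hLcl hdisj
  have hfL : ∀ l ∈ L, f l = 0 := by
    intro l hl
    by_contra hne
    have h1 := hfv (x + ((v - f x) / f l) • l) (by
      simpa using L.smul_mem _ hl)
    rw [map_add, map_smul, smul_eq_mul, div_mul_cancel₀ _ hne] at h1
    linarith
  have hfx : v < f x := hfv x (by simp)
  refine ⟨-f, fun z hz => ?_, fun z hz hfz => ?_⟩
  · by_cases hK : K (x - z)
    · have hl : x - z ∈ L := ⟨hK, by rw [neg_sub]; exact hsub (subset_convexHull ℝ S hz)⟩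
      have := hfL _ hl
      rw [map_sub] at this
      simp only [neg_apply]
      linarith
    · have := hfu z (subset_convexHull ℝ S₀ ⟨hz, hK⟩)
      simp only [neg_apply]
      linarith
  · have hK : K (x - z) := by
      by_contra hK
      have := hfu z (subset_convexHull ℝ S₀ ⟨hz, hK⟩)
      simp only [neg_apply] at hfz
      linarith
    obtain ⟨δ, hδ, hmem⟩ := hK
    refine ⟨δ / (1 + δ), by positivity, by rw [div_lt_one (by positivity)]; linarith, _, hmem, ?_⟩
    have h1 : 1 - δ / (1 + δ) = (1 + δ)⁻¹ := by field_simp; ring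
    rw [h1, div_eq_inv_mul, ← smul_smul, ← smul_add,
      show δ • z + (x + δ • (x - z)) = (1 + δ) • x by module, smul_smul,
      inv_mul_cancel₀ (by positivity), one_smul]

theorem mk_mem_cutBetween {G : SimpleGraph V} {A B : Finset V} {u v : V} :
    s(u, v) ∈ cutBetween G A B ↔ G.Adj u v ∧ (u ∈ A ∧ v ∈ B ∨ v ∈ A ∧ u ∈ B) := by
  simp only [cutBetween, mem_filter, SimpleGraph.mem_edgeFinset, SimpleGraph.mem_edgeSet]
  refine and_congr_right fun _ => ⟨?_, ?_⟩
  · rintro ⟨a, b, hab, ha, hb⟩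
    rcases Sym2.eq_iff.1 hab with ⟨rfl, rfl⟩ | ⟨rfl, rfl⟩
    · exact Or.inl ⟨ha, hb⟩
    · exact Or.inr ⟨ha, hb⟩
  · rintro (⟨ha, hb⟩ | ⟨ha, hb⟩)
    · exact ⟨u, v, rfl, ha, hb⟩
    · exact ⟨v, u, Sym2.eq_swap, ha, hb⟩

theorem mk_mem_cut {G : SimpleGraph V} {S : Finset V} {u v : V} :
    s(u, v) ∈ cut G S ↔ G.Adj u v ∧ (u ∈ S ∧ v ∉ S ∨ v ∈ S ∧ u ∉ S) := by
  simp [cut, mk_mem_cutBetween]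

theorem mk_mem_inducedEdges {G : SimpleGraph V} {S : Finset V} {u v : V} :
    s(u, v) ∈ inducedEdges G S ↔ G.Adj u v ∧ u ∈ S ∧ v ∈ S := by
  simp [inducedEdges]

theorem sum_cutBetween (G : SimpleGraph V) (x : Sym2 V → ℝ) (A B : Finset V) :
    ∑ e ∈ cutBetween G A B, x e =
      ∑ e ∈ G.edgeFinset, if e ∈ cutBetween G A B then x e else 0 := by
  rw [sum_ite_mem, cutBetween, inter_eq_right.2 (filter_subset _ _)]

theorem sum_cut (G : SimpleGraph V) (x : Sym2 V → ℝ) (A : Finset V) :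
    ∑ e ∈ cut G A, x e = ∑ e ∈ G.edgeFinset, if e ∈ cut G A then x e else 0 :=
  sum_cutBetween G x A Aᶜ

theorem sum_inducedEdges (G : SimpleGraph V) (x : Sym2 V → ℝ) (A : Finset V) :
    ∑ e ∈ inducedEdges G A, x e =
      ∑ e ∈ G.edgeFinset, if e ∈ inducedEdges G A then x e else 0 := by
  rw [sum_ite_mem, inducedEdges, inter_eq_right.2 (filter_subset _ _)]

theorem sum_inducedEdges_supermodular {G : SimpleGraph V} {x : Sym2 V → ℝ} (hx : ∀ e, 0 ≤ x e)
    {U W A B : Finset V} (hAB : Disjoint A B) (hU : U ∩ W = A ∪ B) :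
    ∑ e ∈ inducedEdges G U, x e + ∑ e ∈ inducedEdges G W, x e ≤
      ∑ e ∈ inducedEdges G A, x e + ∑ e ∈ inducedEdges G B, x e +
        ∑ e ∈ cutBetween G A B, x e + ∑ e ∈ inducedEdges G (U ∪ W), x e := by
  simp only [sum_inducedEdges, sum_cutBetween, ← sum_add_distrib]
  refine sum_le_sum fun e => ?_
  induction e with | _ u v
  intro he
  have hadj : G.Adj u v := by simpa using he
  have hu : u ∈ U ∧ u ∈ W ↔ u ∈ A ∨ u ∈ B := by rw [← mem_inter, hU, mem_union]
  have hv : v ∈ U ∧ v ∈ W ↔ v ∈ A ∨ v ∈ B := by rw [← mem_inter, hU, mem_union]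
  have hu' : u ∈ A → u ∉ B := fun h => disjoint_left.1 hAB h
  have hv' : v ∈ A → v ∉ B := fun h => disjoint_left.1 hAB h
  have h0 := hx s(u, v)
  simp only [mk_mem_inducedEdges, mk_mem_cutBetween, hadj, true_and, mem_union]
  by_cases h1 : u ∈ U <;> by_cases h2 : u ∈ W <;> by_cases h3 : v ∈ U <;> by_cases h4 : v ∈ W <;>
    by_cases h5 : u ∈ A <;> by_cases h6 : v ∈ A <;>
    simp_all

theorem sum_inducedEdges_disjoint_union {G : SimpleGraph V} {x : Sym2 V → ℝ}
    {A B : Finset V} (hAB : Disjoint A B) :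
    ∑ e ∈ inducedEdges G (A ∪ B), x e =
      ∑ e ∈ inducedEdges G A, x e + ∑ e ∈ inducedEdges G B, x e +
        ∑ e ∈ cutBetween G A B, x e := by
  simp only [sum_inducedEdges, sum_cutBetween, ← sum_add_distrib]
  refine sum_congr rfl fun e => ?_
  induction e with | _ u v
  intro he
  have hadj : G.Adj u v := by simpa using he
  have hu' : u ∈ A → u ∉ B := fun h => disjoint_left.1 hAB h
  have hv' : v ∈ A → v ∉ B := fun h => disjoint_left.1 hAB h
  simp only [mk_mem_inducedEdges, mk_mem_cutBetween, hadj, true_and, mem_union]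
  by_cases h1 : u ∈ A <;> by_cases h2 : v ∈ A <;> by_cases h3 : u ∈ B <;> by_cases h4 : v ∈ B <;>
    simp_all

theorem sum_sum_cut_singleton (G : SimpleGraph V) (x : Sym2 V → ℝ) (Z : Finset V) :
    ∑ v ∈ Z, ∑ e ∈ cut G {v}, x e =
      2 * ∑ e ∈ inducedEdges G Z, x e + ∑ e ∈ cut G Z, x e := by
  simp only [sum_cut, sum_inducedEdges]
  rw [sum_comm, mul_sum, ← sum_add_distrib]
  refine sum_congr rfl fun e => ?_
  induction e with | _ u v
  intro he
  have hadj : G.Adj u v := by simpa using he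
  have hne : u ≠ v := hadj.ne
  have key : ∀ w, (if s(u, v) ∈ cut G {w} then x s(u, v) else 0) =
      (if u = w then x s(u, v) else 0) + (if v = w then x s(u, v) else 0) := by
    intro w
    simp only [mk_mem_cut, hadj, true_and, mem_singleton]
    by_cases h1 : u = w <;> by_cases h2 : v = w <;> simp_all
  rw [sum_congr rfl fun w _ => key w, sum_add_distrib, sum_ite_eq, sum_ite_eq]
  simp only [mk_mem_inducedEdges, mk_mem_cut, hadj, true_and]
  by_cases h1 : u ∈ Z <;> by_cases h2 : v ∈ Z <;> simp [h1, h2]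
  ring

theorem sum_inducedEdges_le {G : SimpleGraph V} {x : Sym2 V → ℝ}
    (hx : x ∈ spanningTreePolytope G) {A : Finset V} (hA : A.Nonempty) :
    ∑ e ∈ inducedEdges G A, x e ≤ #A - 1 := by
  refine sum_le_of_mem_spanningTreePolytope hx fun T hT => ?_
  have h := hT.card_filter_forall_mem_add_one_le hA
  have h2 : inducedEdges G A ∩ T = {e ∈ T | ∀ v ∈ e, v ∈ A} := by
    ext e
    have := @hT.1 e
    simp only [inducedEdges, mem_inter, mem_filter, SimpleGraph.mem_edgeFinset]
    simp only [mem_coe] at this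
    tauto
  rw [h2]
  have : ((#{e ∈ T | ∀ v ∈ e, v ∈ A} + 1 : ℕ) : ℝ) ≤ #A := by exact_mod_cast h
  push_cast at this
  linarith

theorem le_sum_inducedEdges_univ {G : SimpleGraph V} {x : Sym2 V → ℝ}
    (hx : x ∈ spanningTreePolytope G) :
    (Fintype.card V : ℝ) - 1 ≤ ∑ e ∈ inducedEdges G univ, x e := by
  refine le_sum_of_mem_spanningTreePolytope (c := 0) hx (by simp) fun T hT => ?_
  have h2 : inducedEdges G univ ∩ T = T := by
    rw [inter_eq_right]
    intro e he
    simpa [inducedEdges] using hT.1.1 he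
  rw [h2, ← hT.1.card_add_one]
  push_cast
  linarith

theorem sum_inducedEdges_thresholdComponent {G : SimpleGraph V} {x : Sym2 V → ℝ}
    (hx : x ∈ spanningTreePolytope G) {c : Sym2 V → ℝ}
    (hc : ∀ T, IsSpanningTree G T → ∑ e, x e * c e ≤ ∑ e ∈ T, c e) (t : ℝ) (a : V) :
    ∑ e ∈ inducedEdges G (thresholdComponent G c t a), x e =
        #(thresholdComponent G c t a) - 1 ∧
      ∀ e ∈ inducedEdges G (thresholdComponent G c t a), 0 < x e → c e ≤ t := by
  set U := thresholdComponent G c t a with hU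
  have hne : U.Nonempty := ⟨a, mem_thresholdComponent.2 (SimpleGraph.Reachable.refl _)⟩
  have h1 := sum_inducedEdges_le hx hne
  have h2 : (#U : ℝ) - 1 ≤ ∑ e ∈ inducedEdges G U with c e ≤ t, x e := by
    refine le_sum_of_mem_spanningTreePolytope hx hc fun T hT => ?_
    have h := hT.card_thresholdComponent_le t a
    have h2 : {e ∈ inducedEdges G U | c e ≤ t} ∩ T = {e ∈ T | c e ≤ t ∧ ∀ v ∈ e, v ∈ U} := by
      ext e
      have := @hT.1.1 e
      simp only [inducedEdges, mem_inter, mem_filter, SimpleGraph.mem_edgeFinset]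
      simp only [mem_coe] at this
      tauto
    rw [h2, sub_le_iff_le_add]
    exact_mod_cast h
  have h3 := sum_filter_add_sum_filter_not (inducedEdges G U) (fun e => c e ≤ t) x
  have hnn := nonneg_of_mem_spanningTreePolytope hx
  have h4 : 0 ≤ ∑ e ∈ inducedEdges G U with ¬ c e ≤ t, x e := sum_nonneg fun e _ => hnn e
  refine ⟨by linarith, fun e he hpos => ?_⟩
  by_contra hct
  have := single_le_sum (f := x) (fun e _ => hnn e)
    (mem_filter (p := fun e => ¬ c e ≤ t).2 ⟨he, hct⟩)
  linarith

theorem exists_adj_of_tight {G : SimpleGraph V} {x : Sym2 V → ℝ}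
    (hx : x ∈ spanningTreePolytope G) {U W : Finset V}
    (hU : ∑ e ∈ inducedEdges G U, x e = #U - 1)
    (hW : (#W : ℝ) < ∑ e ∈ inducedEdges G W, x e + 2) (r : Setoid V) {a b : V}
    (haU : a ∈ U) (haW : a ∈ W) (hbU : b ∈ U) (hbW : b ∈ W) (hab : ¬ r a b) :
    ∃ u v, u ∈ U ∧ u ∈ W ∧ v ∈ U ∧ v ∈ W ∧ G.Adj u v ∧ 0 < x s(u, v) ∧ ¬ r u v := by
  by_contra! hcon
  have hnn := nonneg_of_mem_spanningTreePolytope hx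
  set A : Finset V := {v ∈ U ∩ W | r a v} with hA
  set B : Finset V := {v ∈ U ∩ W | ¬ r a v} with hB
  have hAB : Disjoint A B := disjoint_filter_filter_not _ _ _
  have hun : U ∩ W = A ∪ B := (filter_union_filter_not_eq _ _).symm
  have h1 := sum_inducedEdges_supermodular (G := G) hnn hAB hun
  have hAne : A.Nonempty := ⟨a, by simp [hA, haU, haW]⟩
  have hBne : B.Nonempty := ⟨b, by simp [hB, hbU, hbW, hab]⟩
  have h2 := sum_inducedEdges_le hx hAne
  have h3 := sum_inducedEdges_le hx hBne
  have h4 := sum_inducedEdges_le hx (A := U ∪ W) ⟨a, mem_union_left _ haU⟩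
  have h5 : ∑ e ∈ cutBetween G A B, x e = 0 := by
    refine sum_eq_zero fun e => ?_
    induction e with | _ u v
    intro he
    by_contra hne
    have hpos : 0 < x s(u, v) := lt_of_le_of_ne (hnn _) (Ne.symm hne)
    obtain ⟨hadj, h⟩ := mk_mem_cutBetween.1 he
    simp only [hA, hB, mem_filter, mem_inter] at h
    rcases h with ⟨⟨⟨hu1, hu2⟩, hu3⟩, ⟨hv1, hv2⟩, hv3⟩ | ⟨⟨⟨hv1, hv2⟩, hv3⟩, ⟨hu1, hu2⟩, hu3⟩
    · exact hv3 (r.trans hu3 (hcon u v hu1 hu2 hv1 hv2 hadj hpos))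
    · exact hu3 (r.trans hv3 (r.symm (hcon u v hu1 hu2 hv1 hv2 hadj hpos)))
  have h6 : (#(U ∪ W) : ℝ) + (#A + #B) = #U + #W := by
    rw [← Nat.cast_add #A, ← card_union_of_disjoint hAB, ← hun]
    exact_mod_cast card_union_add_card_inter U W
  linarith

theorem one_le_sum_cutBetween_of_tight {G : SimpleGraph V} {x : Sym2 V → ℝ}
    (hx : x ∈ spanningTreePolytope G) {U A B : Finset V}
    (hU : ∑ e ∈ inducedEdges G U, x e = #U - 1) (hAB : Disjoint A B) (hun : U = A ∪ B)
    (hA : A.Nonempty) (hB : B.Nonempty) : 1 ≤ ∑ e ∈ cutBetween G A B, x e := by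
  have h1 := sum_inducedEdges_disjoint_union (G := G) (x := x) hAB
  have h2 := sum_inducedEdges_le hx hA
  have h3 := sum_inducedEdges_le hx hB
  have h4 : (#U : ℝ) = #A + #B := by
    rw [hun, card_union_of_disjoint hAB, Nat.cast_add]
  rw [← hun] at h1
  linarith

theorem two_le_sum_cut_of_disjoint_tight {G : SimpleGraph V} {x : Sym2 V → ℝ}
    (hx : x ∈ spanningTreePolytope G) {C D Z : Finset V} (hCD : Disjoint C D)
    (hC : ∑ e ∈ inducedEdges G C, x e = #C - 1) (hD : ∑ e ∈ inducedEdges G D, x e = #D - 1)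
    (hC₁ : (C ∩ Z).Nonempty) (hC₂ : (C \ Z).Nonempty)
    (hD₁ : (D ∩ Z).Nonempty) (hD₂ : (D \ Z).Nonempty) : 2 ≤ ∑ e ∈ cut G Z, x e := by
  have hnn := nonneg_of_mem_spanningTreePolytope hx
  have h1 := one_le_sum_cutBetween_of_tight hx hC (disjoint_sdiff_inter C Z).symm
    (by rw [union_comm, sdiff_union_inter]) hC₁ hC₂
  have h2 := one_le_sum_cutBetween_of_tight hx hD (disjoint_sdiff_inter D Z).symm
    (by rw [union_comm, sdiff_union_inter]) hD₁ hD₂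
  have hdisj : Disjoint (cutBetween G (C ∩ Z) (C \ Z)) (cutBetween G (D ∩ Z) (D \ Z)) := by
    rw [disjoint_left]
    intro e
    induction e with | _ u v
    have hno : ∀ w, w ∈ C → w ∉ D := fun w hw => disjoint_left.1 hCD hw
    simp only [mk_mem_cutBetween, mem_inter, mem_sdiff]
    grind
  have hsub : cutBetween G (C ∩ Z) (C \ Z) ∪ cutBetween G (D ∩ Z) (D \ Z) ⊆ cut G Z := by
    intro e
    induction e with | _ u v
    simp only [mem_union, mk_mem_cutBetween, mk_mem_cut, mem_inter, mem_sdiff]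
    tauto
  have h3 := sum_le_sum_of_subset_of_nonneg (f := x) hsub fun e _ _ => hnn e
  rw [sum_union hdisj] at h3
  linarith

/-- The conditions on a chain-point, expressed through the function `ℓ` sending a vertex to the
index of the level set containing it. -/
structure IsLevelPoint (G : SimpleGraph V) (ℓ : V → ℕ) (k : ℕ) (x : Sym2 V → ℝ) : Prop where
  mem : x ∈ spanningTreePolytope G
  le : ∀ v, ℓ v ≤ k + 1
  surj : ∀ p ≤ k + 1, ∃ v, ℓ v = p
  cut_bot : ∑ e ∈ cut G {v | ℓ v < 1}, x e = 1
  cut_top : ∑ e ∈ cut G {v | ℓ v < k + 1}, x e = 1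
  cut_lt : ∀ p, 1 ≤ p → p ≤ k + 1 → ∑ e ∈ cut G {v | ℓ v < p}, x e < 2
  degree : ∀ i, 1 ≤ i → i ≤ k →
    ∑ v with ℓ v = i, ∑ e ∈ cut G {v}, x e = 2 * (#{v | ℓ v = i} : ℝ)

theorem sum_sum_cut_singleton_of_sum_cut_eq_one {G : SimpleGraph V} {x : Sym2 V → ℝ}
    (hx : x ∈ spanningTreePolytope G) {A : Finset V} (hA : A.Nonempty) (hA' : Aᶜ.Nonempty)
    (hcut : ∑ e ∈ cut G A, x e = 1) :
    ∑ v ∈ A, ∑ e ∈ cut G {v}, x e = 2 * (#A : ℝ) - 1 ∧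
      ∑ v ∈ Aᶜ, ∑ e ∈ cut G {v}, x e = 2 * (#Aᶜ : ℝ) - 1 := by
  have h1 := le_sum_inducedEdges_univ hx
  have h2 := sum_inducedEdges_disjoint_union (G := G) (x := x) (disjoint_compl_right (a := A))
  have h3 := sum_inducedEdges_le hx hA
  have h4 := sum_inducedEdges_le hx hA'
  have h5 : (#A : ℝ) + #Aᶜ = Fintype.card V := by exact_mod_cast card_add_card_compl A
  have h6 : ∑ e ∈ cut G Aᶜ, x e = ∑ e ∈ cut G A, x e := by
    congr 1
    ext e
    induction e with | _ u v
    simp only [mk_mem_cut, mem_compl]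
    tauto
  rw [union_compl] at h2
  change _ = _ + _ + ∑ e ∈ cut G A, x e at h2
  have h7 := sum_sum_cut_singleton G x A
  have h8 := sum_sum_cut_singleton G x Aᶜ
  constructor <;> linarith

theorem sum_cut_interval (G : SimpleGraph V) (x : Sym2 V → ℝ) (ℓ : V → ℕ) {p q : ℕ}
    (hpq : p ≤ q) :
    ∑ e ∈ cut G {v | p ≤ ℓ v ∧ ℓ v ≤ q}, x e +
        2 * ∑ e ∈ cutBetween G {v | ℓ v < p} {v | q < ℓ v}, x e =
      ∑ e ∈ cut G {v | ℓ v < p}, x e + ∑ e ∈ cut G {v | ℓ v < q + 1}, x e := by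
  simp only [sum_cut, sum_cutBetween, mul_sum, ← sum_add_distrib]
  refine sum_congr rfl fun e => ?_
  induction e with | _ u v
  intro he
  have hadj : G.Adj u v := by simpa using he
  simp only [mk_mem_cut, mk_mem_cutBetween, hadj, true_and, mem_filter, mem_univ]
  rcases lt_or_ge (ℓ u) p with h1 | h1 <;> rcases lt_or_ge (ℓ v) p with h2 | h2 <;>
    rcases lt_or_ge q (ℓ u) with h3 | h3 <;> rcases lt_or_ge q (ℓ v) with h4 | h4 <;>
    simp [h1, h2, h3, h4, not_le.2, not_lt.2] <;>
    first | omega | ring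

namespace IsLevelPoint

variable {G : SimpleGraph V} {ℓ : V → ℕ} {k : ℕ} {x : Sym2 V → ℝ}

theorem sum_degree_level (h : IsLevelPoint G ℓ k x) {i : ℕ} (hi : i ≤ k + 1) :
    ∑ v with ℓ v = i, ∑ e ∈ cut G {v}, x e =
      2 * (#{v | ℓ v = i} : ℝ) - (if i = 0 then 1 else 0) - (if i = k + 1 then 1 else 0) := by
  obtain ⟨a, ha⟩ := h.surj 0 (by omega)
  obtain ⟨b, hb⟩ := h.surj (k + 1) le_rfl
  rcases Nat.eq_zero_or_pos i with rfl | h0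
  · have := (sum_sum_cut_singleton_of_sum_cut_eq_one h.mem ⟨a, by simp [ha]⟩
      ⟨b, by simp [hb]⟩ h.cut_bot).1
    simpa using this
  rcases hi.eq_or_lt with rfl | hlt
  · have := (sum_sum_cut_singleton_of_sum_cut_eq_one h.mem ⟨a, by simp [ha]⟩
      ⟨b, by simp [hb]⟩ h.cut_top).2
    have heq : ({v | ℓ v < k + 1} : Finset V)ᶜ = ({v | ℓ v = k + 1} : Finset V) := by
      ext v
      have := h.le v
      simp only [mem_compl, mem_filter, mem_univ, true_and]
      omega
    rw [heq] at this
    simpa using this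
  · rw [h.degree i h0 (by omega), if_neg h0.ne', if_neg hlt.ne]
    ring

theorem sum_degree_interval (h : IsLevelPoint G ℓ k x) {p q : ℕ} (hpq : p ≤ q)
    (hq : q ≤ k + 1) :
    ∑ v with p ≤ ℓ v ∧ ℓ v ≤ q, ∑ e ∈ cut G {v}, x e =
      2 * (#{v | p ≤ ℓ v ∧ ℓ v ≤ q} : ℝ) - (if p = 0 then 1 else 0) -
        (if q = k + 1 then 1 else 0) := by
  have hmaps : ∀ v ∈ ({v | p ≤ ℓ v ∧ ℓ v ≤ q} : Finset V), ℓ v ∈ Icc p q := by simp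
  have hfib : ∀ i ∈ Icc p q, ({v ∈ ({v | p ≤ ℓ v ∧ ℓ v ≤ q} : Finset V) | ℓ v = i}) =
      ({v | ℓ v = i} : Finset V) := by
    intro i hi
    rw [mem_Icc] at hi
    ext v
    simp only [mem_filter, mem_univ, true_and]
    omega
  rw [← sum_fiberwise_of_maps_to hmaps, card_eq_sum_card_fiberwise hmaps]
  have h1 : ∀ i ∈ Icc p q, ∑ v ∈ ({v | p ≤ ℓ v ∧ ℓ v ≤ q} : Finset V) with ℓ v = i,
      ∑ e ∈ cut G {v}, x e = 2 * (#{v | ℓ v = i} : ℝ) - (if i = 0 then 1 else 0) -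
        (if i = k + 1 then 1 else 0) := by
    intro i hi
    rw [hfib i hi]
    exact h.sum_degree_level ((mem_Icc.1 hi).2.trans hq)
  have h2 : ∀ i ∈ Icc p q, #{v ∈ ({v | p ≤ ℓ v ∧ ℓ v ≤ q} : Finset V) | ℓ v = i} =
      #{v | ℓ v = i} := fun i hi => by rw [hfib i hi]
  rw [sum_congr rfl h1, sum_congr rfl h2, sum_sub_distrib,
    sum_sub_distrib, ← mul_sum, sum_ite_eq', sum_ite_eq', Nat.cast_sum]
  simp only [mem_Icc]
  congr 2
  · simp only [nonpos_iff_eq_zero, zero_le, and_true]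
  · congr 1
    exact propext ⟨fun h => by omega, fun h => by omega⟩

theorem card_interval_lt (h : IsLevelPoint G ℓ k x) {p q : ℕ} (hpq : p ≤ q) (hq : q ≤ k + 1) :
    (#{v | p ≤ ℓ v ∧ ℓ v ≤ q} : ℝ) + ∑ e ∈ cutBetween G {v | ℓ v < p} {v | q < ℓ v}, x e <
      ∑ e ∈ inducedEdges G {v | p ≤ ℓ v ∧ ℓ v ≤ q}, x e + 2 := by
  have h1 := h.sum_degree_interval hpq hq
  have h2 := sum_cut_interval G x ℓ hpq
  have h3 := sum_sum_cut_singleton G x {v | p ≤ ℓ v ∧ ℓ v ≤ q}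
  have h4 : ∑ e ∈ cut G {v | ℓ v < p}, x e + (if p = 0 then 1 else 0) < 2 := by
    rcases Nat.eq_zero_or_pos p with rfl | hp
    · simp [cut, cutBetween]
    · rw [if_neg hp.ne', add_zero]
      exact h.cut_lt p hp (hpq.trans hq)
  have h5 : ∑ e ∈ cut G {v | ℓ v < q + 1}, x e + (if q = k + 1 then 1 else 0) < 2 := by
    rcases hq.eq_or_lt with rfl | hq
    · have : ∀ v, ℓ v < k + 1 + 1 := fun v => Nat.lt_succ_of_le (h.le v)
      simp [cut, cutBetween, this]
    · rw [if_neg hq.ne, add_zero]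
      exact h.cut_lt (q + 1) (by omega) (by omega)
  linarith

theorem exists_mem_level_of_tight (h : IsLevelPoint G ℓ k x) {U : Finset V}
    (hU : ∑ e ∈ inducedEdges G U, x e = #U - 1) {p : ℕ} (hp : p ≤ k + 1) {a b : V}
    (ha : a ∈ U) (hb : b ∈ U) (hap : ℓ a < p) (hbp : p < ℓ b) : ∃ m ∈ U, ℓ m = p := by
  by_contra! hcon
  have hnn := nonneg_of_mem_spanningTreePolytope h.mem
  have h1 := one_le_sum_cutBetween_of_tight h.mem hU
    (A := {v ∈ U | ℓ v < p}) (B := {v ∈ U | p < ℓ v})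
    (disjoint_filter.2 fun v _ hv => by omega)
    (by
      ext v
      have := hcon v
      simp only [mem_union, mem_filter]
      grind)
    ⟨a, by simp [ha, hap]⟩ ⟨b, by simp [hb, hbp]⟩
  have h2 : ∑ e ∈ cutBetween G {v ∈ U | ℓ v < p} {v ∈ U | p < ℓ v}, x e ≤
      ∑ e ∈ cutBetween G {v | ℓ v < p} {v | p < ℓ v}, x e := by
    refine sum_le_sum_of_subset_of_nonneg (fun e => ?_) fun e _ _ => hnn e
    induction e with | _ u v
    simp only [mk_mem_cutBetween, mem_filter, mem_univ]
    tauto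
  obtain ⟨v, hv⟩ := h.surj p hp
  have h3 := h.card_interval_lt le_rfl hp
  have h4 := sum_inducedEdges_le h.mem (A := {v | p ≤ ℓ v ∧ ℓ v ≤ p})
    ⟨v, by simp [hv]⟩
  linarith

end IsLevelPoint

/-- The number of levels separating the endpoints of a pair of vertices. -/
def levelDist (ℓ : V → ℕ) : Sym2 V → ℕ :=
  Sym2.lift ⟨fun u v => (ℓ u - ℓ v) + (ℓ v - ℓ u), fun _ _ => add_comm _ _⟩

theorem levelDist_mk (ℓ : V → ℕ) (u v : V) :
    levelDist ℓ s(u, v) = (ℓ u - ℓ v) + (ℓ v - ℓ u) := rfl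

/-- A minimum cost spanning tree whose edges, among all such trees, span as few levels as
possible in total. -/
def IsShortestMinCostTree (G : SimpleGraph V) (ℓ : V → ℕ) (c : Sym2 V → ℝ)
    (T : Finset (Sym2 V)) : Prop :=
  IsMinCostTree G c T ∧ ∀ S, IsMinCostTree G c S → ∑ e ∈ T, levelDist ℓ e ≤ ∑ e ∈ S, levelDist ℓ e

theorem exists_isShortestMinCostTree {G : SimpleGraph V} (hG : ∃ T, IsSpanningTree G T)
    (ℓ : V → ℕ) (c : Sym2 V → ℝ) : ∃ T, IsShortestMinCostTree G ℓ c T := by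
  obtain ⟨T₀, hT₀⟩ := hG
  obtain ⟨T₁, hT₁, hmin₁⟩ := exists_min_image ({T | IsSpanningTree G T} : Finset (Finset (Sym2 V)))
    (fun T => ∑ e ∈ T, c e) ⟨T₀, by simpa using hT₀⟩
  have hT₁' : IsMinCostTree G c T₁ :=
    ⟨by simpa using hT₁, fun S hS => hmin₁ S (by simpa using hS)⟩
  obtain ⟨T, hT, hmin⟩ := exists_min_image ({T | IsMinCostTree G c T} : Finset (Finset (Sym2 V)))
    (fun T => ∑ e ∈ T, levelDist ℓ e) ⟨T₁, by simpa using hT₁'⟩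
  exact ⟨T, by simpa using hT, fun S hS => hmin S (by simpa using hS)⟩

namespace IsShortestMinCostTree

variable {G : SimpleGraph V} {ℓ : V → ℕ} {c : Sym2 V → ℝ} {T : Finset (Sym2 V)}

theorem levelDist_le_of_exchange (hT : IsShortestMinCostTree G ℓ c T) {f : Sym2 V} (hf : f ∈ T)
    {u v : V} (huv : G.Adj u v) (hnr : ¬ (edgeGraph (T.erase f)).Reachable u v)
    (hcost : c s(u, v) ≤ c f) : levelDist ℓ f ≤ levelDist ℓ s(u, v) := by
  obtain ⟨hnot, hS⟩ := hT.1.1.exchange hf huv hnr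
  have hcS : ∑ e ∈ insert s(u, v) (T.erase f), c e ≤ ∑ e ∈ T, c e := by
    rw [sum_insert hnot, ← add_sum_erase T c hf]
    linarith
  have hle := hT.2 _ ⟨hS, fun S' hS' => hcS.trans (hT.1.2 S' hS')⟩
  rw [sum_insert hnot, ← add_sum_erase T _ hf] at hle
  omega

variable {k : ℕ} {x : Sym2 V → ℝ}

theorem levelDist_le_of_interval (hT : IsShortestMinCostTree G ℓ c T)
    (hx : IsLevelPoint G ℓ k x)
    (hc : ∀ T, IsSpanningTree G T → ∑ e, x e * c e ≤ ∑ e ∈ T, c e) {f : Sym2 V} (hf : f ∈ T)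
    {p q : ℕ} (hpq : p ≤ q) (hq : q ≤ k + 1) {a u v : V}
    (hu : u ∈ thresholdComponent G c (c f) a) (hv : v ∈ thresholdComponent G c (c f) a)
    (hu' : p ≤ ℓ u ∧ ℓ u ≤ q) (hv' : p ≤ ℓ v ∧ ℓ v ≤ q)
    (hnr : ¬ (edgeGraph (T.erase f)).Reachable u v) : levelDist ℓ f ≤ q - p := by
  obtain ⟨htight, hle⟩ := sum_inducedEdges_thresholdComponent hx.mem hc (c f) a
  have hnn := nonneg_of_mem_spanningTreePolytope hx.mem
  have hW := hx.card_interval_lt hpq hq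
  have hJ : 0 ≤ ∑ e ∈ cutBetween G {v | ℓ v < p} {v | q < ℓ v}, x e :=
    sum_nonneg fun e _ => hnn e
  obtain ⟨y, z, hyU, hyW, hzU, hzW, hyz, hpos, hr⟩ := exists_adj_of_tight hx.mem htight
    (W := {v | p ≤ ℓ v ∧ ℓ v ≤ q}) (by linarith) (edgeGraph (T.erase f)).reachableSetoid
    hu (by simpa using hu') hv (by simpa using hv') hnr
  have h1 := hT.levelDist_le_of_exchange hf hyz hr
    (hle _ (mk_mem_inducedEdges.2 ⟨hyz, hyU, hzU⟩) hpos)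
  rw [levelDist_mk] at h1
  simp only [mem_filter, mem_univ, true_and] at hyW hzW
  omega

theorem mem_thresholdComponent_of_mem (hT : IsShortestMinCostTree G ℓ c T) {a b : V}
    (hf : s(a, b) ∈ T) {t : ℝ} (ht : c s(a, b) ≤ t) {y : V}
    (ha : a ∈ thresholdComponent G c t y) : b ∈ thresholdComponent G c t y := by
  rw [mem_thresholdComponent] at ha ⊢
  refine ha.trans (SimpleGraph.Adj.reachable ?_)
  exact thresholdGraph_adj.2 ⟨hT.1.1.1 hf, ht⟩

theorem levelDist_le_one (hT : IsShortestMinCostTree G ℓ c T) (hx : IsLevelPoint G ℓ k x)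
    (hc : ∀ T, IsSpanningTree G T → ∑ e, x e * c e ≤ ∑ e ∈ T, c e) {a b : V}
    (hf : s(a, b) ∈ T) : ℓ b ≤ ℓ a + 1 := by
  by_contra! hlt
  have haU : a ∈ thresholdComponent G c (c s(a, b)) a :=
    mem_thresholdComponent.2 (SimpleGraph.Reachable.refl _)
  have hbU := hT.mem_thresholdComponent_of_mem hf le_rfl haU
  have hb := hx.le b
  obtain ⟨m, hmU, hm⟩ := hx.exists_mem_level_of_tight
    (sum_inducedEdges_thresholdComponent hx.mem hc (c s(a, b)) a).1 (p := ℓ a + 1) (by omega)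
    haU hbU (by omega) hlt
  refine hT.1.1.not_reachable_erase hf (SimpleGraph.Reachable.trans (v := m) ?_ ?_)
  · by_contra hr
    have := hT.levelDist_le_of_interval hx hc hf (p := ℓ a) (q := ℓ a + 1) (by omega) (by omega)
      haU hmU (by omega) (by omega) hr
    rw [levelDist_mk] at this
    omega
  · by_contra hr
    have := hT.levelDist_le_of_interval hx hc hf (p := ℓ a + 1) (q := ℓ b) (by omega) (by omega)
      hmU hbU (by omega) (by omega) hr
    rw [levelDist_mk] at this
    omega

theorem exists_eq_of_mem_cut (hT : IsShortestMinCostTree G ℓ c T) (hx : IsLevelPoint G ℓ k x)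
    (hc : ∀ T, IsSpanningTree G T → ∑ e, x e * c e ≤ ∑ e ∈ T, c e) {f : Sym2 V} {i : ℕ}
    (hf : f ∈ T ∩ cut G {v | ℓ v < i + 1}) :
    ∃ a b, f = s(a, b) ∧ ℓ a = i ∧ ℓ b = i + 1 := by
  induction f with | _ u v
  obtain ⟨hfT, hfc⟩ := mem_inter.1 hf
  simp only [mk_mem_cut, mem_filter, mem_univ, true_and] at hfc
  rcases hfc.2 with h | h
  · have := hT.levelDist_le_one hx hc hfT
    exact ⟨u, v, rfl, by omega, by omega⟩
  · have := hT.levelDist_le_one hx hc (a := v) (b := u) (by rwa [Sym2.eq_swap])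
    exact ⟨v, u, Sym2.eq_swap, by omega, by omega⟩

theorem eq_of_mem_cut (hT : IsShortestMinCostTree G ℓ c T) (hx : IsLevelPoint G ℓ k x)
    (hc : ∀ T, IsSpanningTree G T → ∑ e, x e * c e ≤ ∑ e ∈ T, c e) {f g : Sym2 V} {i : ℕ}
    (hi : i ≤ k) (hf : f ∈ T ∩ cut G {v | ℓ v < i + 1}) (hg : g ∈ T ∩ cut G {v | ℓ v < i + 1})
    (hfg : c g ≤ c f) : f = g := by
  by_contra hne
  obtain ⟨a, b, rfl, ha, hb⟩ := hT.exists_eq_of_mem_cut hx hc hf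
  obtain ⟨a', b', rfl, ha', hb'⟩ := hT.exists_eq_of_mem_cut hx hc hg
  have hfT := (mem_inter.1 hf).1
  have hgT := (mem_inter.1 hg).1
  set t := c s(a, b) with ht
  have haU : a ∈ thresholdComponent G c t a :=
    mem_thresholdComponent.2 (SimpleGraph.Reachable.refl _)
  have hbU : b ∈ thresholdComponent G c t a := hT.mem_thresholdComponent_of_mem hfT le_rfl haU
  by_cases ha'U : a' ∈ thresholdComponent G c t a
  · have hb'U := hT.mem_thresholdComponent_of_mem hgT hfg ha'U
    have hadj : (edgeGraph (T.erase s(a, b))).Adj a' b' :=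
      (edgeGraph_adj ((coe_subset.2 (erase_subset _ _)).trans hT.1.1.1)).2
        (mem_erase.2 ⟨Ne.symm hne, hgT⟩)
    refine hT.1.1.not_reachable_erase hfT (SimpleGraph.Reachable.trans (v := a') ?_
      (hadj.reachable.trans ?_))
    · by_contra hr
      have := hT.levelDist_le_of_interval hx hc hfT (p := i) (q := i) le_rfl (by omega)
        haU ha'U (by omega) (by omega) hr
      rw [levelDist_mk] at this
      omega
    · by_contra hr
      have := hT.levelDist_le_of_interval hx hc hfT (p := i + 1) (q := i + 1) le_rfl (by omega)
        hb'U hbU (by omega) (by omega) hr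
      rw [levelDist_mk] at this
      omega
  · have ha'U' : a' ∈ thresholdComponent G c t a' :=
      mem_thresholdComponent.2 (SimpleGraph.Reachable.refl _)
    have hb'U' := hT.mem_thresholdComponent_of_mem hgT hfg ha'U'
    have hdisj : Disjoint (thresholdComponent G c t a) (thresholdComponent G c t a') := by
      rw [disjoint_left]
      intro v hv hv'
      rw [mem_thresholdComponent] at hv hv' ha'U
      exact ha'U (hv.trans hv'.symm)
    have h1 := two_le_sum_cut_of_disjoint_tight hx.mem (Z := {v | ℓ v < i + 1}) hdisj
      (sum_inducedEdges_thresholdComponent hx.mem hc t a).1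
      (sum_inducedEdges_thresholdComponent hx.mem hc t a').1
      ⟨a, by simp [haU, ha]⟩ ⟨b, by simp [hbU, hb]⟩ ⟨a', by simp [ha'U', ha']⟩
      ⟨b', by simp [hb'U', hb']⟩
    linarith [hx.cut_lt (i + 1) (by omega) (by omega)]

theorem card_inter_cut (hT : IsShortestMinCostTree G ℓ c T) (hx : IsLevelPoint G ℓ k x)
    (hc : ∀ T, IsSpanningTree G T → ∑ e, x e * c e ≤ ∑ e ∈ T, c e) {i : ℕ} (hi : i ≤ k) :
    #(T ∩ cut G {v | ℓ v < i + 1}) = 1 := by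
  refine le_antisymm (card_le_one.2 fun f hf g hg => ?_) (card_pos.2 ?_)
  · rcases le_total (c g) (c f) with h | h
    · exact hT.eq_of_mem_cut hx hc hi hf hg h
    · exact (hT.eq_of_mem_cut hx hc hi hg hf h).symm
  · obtain ⟨a, ha⟩ := hx.surj 0 (by omega)
    obtain ⟨b, hb⟩ := hx.surj (k + 1) le_rfl
    obtain ⟨w⟩ := hT.1.1.2.1.preconnected a b
    obtain ⟨d, -, hd₁, hd₂⟩ := w.exists_boundary_dart {v | ℓ v < i + 1} (by simp [ha])
      (by simp [hb, hi])
    have hd := (edgeGraph_adj hT.1.1.1).1 d.adj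
    refine ⟨s(d.fst, d.snd), mem_inter.2 ⟨hd, mk_mem_cut.2 ⟨hT.1.1.1 hd, Or.inl ?_⟩⟩⟩
    simp only [Set.mem_ofPred_eq] at hd₁ hd₂
    simp only [mem_filter, mem_univ, true_and]
    exact ⟨hd₁, hd₂⟩

end IsShortestMinCostTree

/-- The index of the level set of the chain `V_0 ⊊ … ⊊ V_k` containing a given vertex. -/
noncomputable def chainLevel (Vc : ℕ → Finset V) (k : ℕ) (v : V) : ℕ :=
  #{i ∈ range (k + 1) | v ∉ Vc i}

theorem chainLevel_lt_iff {Vc : ℕ → Finset V} {k : ℕ} (hchain : ∀ i < k, Vc i ⊂ Vc (i + 1))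
    {i : ℕ} (hi : i ≤ k) {v : V} : chainLevel Vc k v < i + 1 ↔ v ∈ Vc i := by
  have hmono : ∀ i j, i ≤ j → j ≤ k → Vc i ⊆ Vc j := by
    intro i j hij
    induction j, hij using Nat.le_induction with
    | base => exact fun _ => Subset.rfl
    | succ j _ ih => exact fun hj => (ih (by omega)).trans (hchain j hj).subset
  constructor
  · intro hlt
    by_contra hv
    have hsub : range (i + 1) ⊆ {j ∈ range (k + 1) | v ∉ Vc j} := by
      intro j hj
      rw [mem_range] at hj
      exact mem_filter.2 ⟨mem_range.2 (by omega), fun h => hv (hmono j i (by omega) hi h)⟩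
    have := card_le_card hsub
    rw [card_range] at this
    exact absurd hlt (not_lt.2 this)
  · intro hv
    have hsub : {j ∈ range (k + 1) | v ∉ Vc j} ⊆ range i := by
      intro j hj
      rw [mem_filter, mem_range] at hj
      by_contra hij
      rw [mem_range, not_lt] at hij
      exact hj.2 (hmono i j hij (by omega) hv)
    have := card_le_card hsub
    rw [card_range] at this
    exact Nat.lt_succ_of_le this

theorem filter_chainLevel_lt {Vc : ℕ → Finset V} {k : ℕ} (hchain : ∀ i < k, Vc i ⊂ Vc (i + 1))
    {i : ℕ} (hi : i ≤ k) : ({v | chainLevel Vc k v < i + 1} : Finset V) = Vc i := by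
  ext v
  simp only [mem_filter, mem_univ, true_and]
  exact chainLevel_lt_iff hchain hi

theorem filter_chainLevel_eq {Vc : ℕ → Finset V} {k : ℕ} (hchain : ∀ i < k, Vc i ⊂ Vc (i + 1))
    {i : ℕ} (h0 : 1 ≤ i) (hi : i ≤ k) :
    ({v | chainLevel Vc k v = i} : Finset V) = level Vc k i := by
  ext v
  have h1 := chainLevel_lt_iff hchain hi (v := v)
  have h2 := chainLevel_lt_iff hchain (i := i - 1) (by omega) (v := v)
  simp only [level, if_neg (Nat.one_le_iff_ne_zero.1 h0), if_pos hi, mem_filter, mem_univ,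
    true_and, mem_sdiff, ← h1, ← h2]
  omega

theorem IsChainPoint.sum_cut_lt {G : SimpleGraph V} {Vc : ℕ → Finset V} {k : ℕ}
    {x : Sym2 V → ℝ} (hx : IsChainPoint G Vc k x) {i : ℕ} (hi : i ≤ k) :
    ∑ e ∈ cut G (Vc i), x e < 2 := by
  obtain ⟨-, h0, hk, hmid, -⟩ := hx
  rcases Nat.eq_zero_or_pos i with rfl | hpos
  · linarith
  rcases hi.eq_or_lt with rfl | hlt
  · linarith
  · exact hmid i hpos (by omega)

theorem IsChainPoint.isLevelPoint {G : SimpleGraph V} {Vc : ℕ → Finset V} {k : ℕ}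
    {x : Sym2 V → ℝ} (hx : IsChainPoint G Vc k x) (hne : (Vc 0).Nonempty)
    (hchain : ∀ i < k, Vc i ⊂ Vc (i + 1)) (htop : Vc k ⊂ univ) :
    IsLevelPoint G (chainLevel Vc k) k x where
  mem := hx.1
  le v := (card_filter_le _ _).trans (card_range _).le
  surj p hp := by
    rcases Nat.eq_zero_or_pos p with rfl | hpos
    · obtain ⟨v, hv⟩ := hne
      exact ⟨v, Nat.lt_one_iff.1 ((chainLevel_lt_iff hchain (Nat.zero_le k)).2 hv)⟩
    obtain ⟨j, rfl⟩ := Nat.exists_eq_add_of_le' hpos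
    rcases hp.eq_or_lt with hjk | hlt
    · obtain rfl : j = k := by omega
      obtain ⟨v, -, hv⟩ := exists_of_ssubset htop
      rw [← chainLevel_lt_iff hchain le_rfl] at hv
      exact ⟨v, le_antisymm ((card_filter_le _ _).trans (card_range _).le) (not_lt.1 hv)⟩
    · obtain ⟨v, hv, hv'⟩ := exists_of_ssubset (hchain j (by omega))
      rw [← chainLevel_lt_iff hchain (by omega)] at hv hv'
      exact ⟨v, by omega⟩
  cut_bot := by
    rw [← hx.2.1, ← filter_chainLevel_lt hchain (Nat.zero_le k)]
  cut_top := by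
    rw [← hx.2.2.1, ← filter_chainLevel_lt hchain le_rfl]
  cut_lt p hp hpk := by
    obtain ⟨j, rfl⟩ := Nat.exists_eq_add_of_le' hp
    rw [filter_chainLevel_lt hchain (by omega)]
    exact hx.sum_cut_lt (by omega)
  degree i h0 hi := by
    rw [filter_chainLevel_eq hchain h0 hi]
    exact hx.2.2.2.2 i h0 hi

/-- A chain-point carries positive weight on some Gao-tree. -/
theorem IsChainPoint.exists_isGaoTree {G : SimpleGraph V} {Vc : ℕ → Finset V} {k : ℕ}
    {x : Sym2 V → ℝ} (hx : IsChainPoint G Vc k x) (hne : (Vc 0).Nonempty)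
    (hchain : ∀ i < k, Vc i ⊂ Vc (i + 1)) (htop : Vc k ⊂ univ) :
    ∃ T, IsGaoTree G Vc k T ∧ ∃ ε : ℝ, 0 < ε ∧ ε < 1 ∧
      ∃ x' ∈ spanningTreePolytope G, x = ε • chi T + (1 - ε) • x' := by
  have hfin : {x | ∃ T : Finset (Sym2 V), IsSpanningTree G T ∧ x = chi T}.Finite := by
    refine (Set.finite_range (chi (V := V))).subset ?_
    rintro _ ⟨T, -, rfl⟩
    exact ⟨T, rfl⟩
  obtain ⟨f, hmin, hface⟩ := exists_supporting_functional hfin hx.1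
  set c : Sym2 V → ℝ := fun e => f (Pi.single e 1) with hcdef
  have hf : ∀ z, f z = ∑ e, z e * c e := by
    intro z
    conv_lhs => rw [pi_eq_sum_univ' z]
    simp [hcdef, map_sum]
  have hc : ∀ T, IsSpanningTree G T → ∑ e, x e * c e ≤ ∑ e ∈ T, c e := by
    intro T hT
    rw [← hf, ← sum_chi_mul, ← hf]
    exact hmin _ ⟨T, hT, rfl⟩
  have htree : ∃ T, IsSpanningTree G T := by
    obtain ⟨_, T, hT, -⟩ := convexHull_nonempty_iff.1 ⟨x, hx.1⟩
    exact ⟨T, hT⟩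
  have hℓ := hx.isLevelPoint hne hchain htop
  obtain ⟨T, hT⟩ := exists_isShortestMinCostTree htree (chainLevel Vc k) c
  have hTx : f (chi T) = f x := by
    refine le_antisymm ?_ (hmin _ ⟨T, hT.1.1, rfl⟩)
    have hsub : spanningTreePolytope G ⊆ {z | f (chi T) ≤ f z} := by
      refine convexHull_min ?_ (convex_halfSpace_ge f.toLinearMap.isLinear _)
      rintro _ ⟨S, hS, rfl⟩
      simp only [Set.mem_ofPred_eq, hf, sum_chi_mul]
      exact hT.1.2 S hS
    exact hsub hx.1
  refine ⟨T, ⟨hT.1.1, fun i hi => ?_⟩, hface _ ⟨T, hT.1.1, rfl⟩ hTx⟩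
  rw [← filter_chainLevel_lt hchain hi]
  exact hT.card_inter_cut hℓ hc hi

theorem stmt11 (G : SimpleGraph V) (hG : G.Connected)
    (Vc : ℕ → Finset V) (k : ℕ)
    (hne : (Vc 0).Nonempty) (hchain : ∀ i < k, Vc i ⊂ Vc (i + 1))
    (htop : Vc k ⊂ Finset.univ)
    (x : Sym2 V → ℝ) (hx : IsChainPoint G Vc k x)
    (lam : ℝ)
    (hlam : lam = 2 - (Finset.range (k + 1)).sup'
      (Finset.nonempty_range_iff.mpr (Nat.succ_ne_zero k))
      (fun i => ∑ e ∈ cut G (Vc i), x e)) :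
    ∃ ε : ℝ, 0 < ε ∧ ε ≤ lam ∧
      ∃ y ∈ gaoPolytope G Vc k, ∃ x' ∈ spanningTreePolytope G,
        x = fun e => ε * y e + (1 - ε) * x' e := by
  obtain ⟨T, hT, ε, hε, hε1, x', hx', hxeq⟩ := hx.exists_isGaoTree hne hchain htop
  have hlam0 : 0 < lam := by
    rw [hlam, sub_pos, Finset.sup'_lt_iff]
    exact fun i hi => hx.sum_cut_lt (Nat.lt_succ_iff.1 (mem_range.1 hi))
  set η := min ε lam with hη
  have hηε : η ≤ ε := min_le_left _ _
  have h1 : 0 < 1 - η := by linarith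
  have hTmem : chi T ∈ spanningTreePolytope G :=
    subset_convexHull ℝ {x | ∃ T, IsSpanningTree G T ∧ x = chi T} ⟨T, hT.1, rfl⟩
  refine ⟨η, lt_min hε hlam0, min_le_right _ _, chi T, subset_convexHull ℝ _ ⟨T, hT, rfl⟩,
    ((ε - η) / (1 - η)) • chi T + ((1 - ε) / (1 - η)) • x', ?_, ?_⟩
  · refine convex_convexHull ℝ {x | ∃ T, IsSpanningTree G T ∧ x = chi T} hTmem hx'
      (div_nonneg (by linarith) h1.le) (div_nonneg (by linarith) h1.le) ?_
    rw [← add_div, div_eq_one_iff_eq h1.ne']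
    ring
  · funext e
    conv_lhs => rw [hxeq]
    simp only [Pi.add_apply, Pi.smul_apply, smul_eq_mul]
    field_simp
    ring
end

section
/- Let x be a chain-point for the chain V_0 ⊊ V_1 ⊊ … ⊊ V_k and let λ := 2 − max_{i=0,…,k} x(δ(V_i)). For X ⊆ E define p(X) := max over Gao-trees T of |T ∩ X| and r(X) := max over spanning trees T of G of |T ∩ X|. Then for every X ⊆ E: λ·p(X) + (1−λ)·r(X) ≥ x(X). -/
open Finset
open scoped Classical

variable {V : Type*} [Fintype V]

/-- Total weight of the ordered pairs satisfying `P`. -/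
noncomputable def pairSum (w : V → V → ℝ) (P : V → V → Prop) : ℝ :=
  ∑ u, ∑ v, if P u v then w u v else 0

/-- The properties of a chain-point, expressed through its symmetric weight function and the
function `lev` sending a vertex to the index of its level. -/
structure IsChainWeight (w : V → V → ℝ) (lev : V → ℕ) (k : ℕ) (lam : ℝ) : Prop where
  symm : ∀ u v, w u v = w v u
  nonneg : ∀ u v, 0 ≤ w u v
  sparse : ∀ S : Finset V, S.Nonempty → ∑ u ∈ S, ∑ v ∈ S, w u v ≤ 2 * ((S.card : ℝ) - 1)
  lev_le : ∀ v, lev v ≤ k + 1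
  lev_surj : ∀ i ≤ k + 1, ∃ v, lev v = i
  deg : ∀ i, 1 ≤ i → i ≤ k →
    pairSum w (fun u _ => lev u = i) = 2 * ((univ.filter fun v => lev v = i).card : ℝ)
  deg_bot : pairSum w (fun u _ => lev u = 0) = 2 * ((univ.filter fun v => lev v = 0).card : ℝ) - 1
  deg_top : pairSum w (fun u _ => lev u = k + 1) =
    2 * ((univ.filter fun v => lev v = k + 1).card : ℝ) - 1
  cut_le : ∀ i ≤ k, pairSum w (fun u v => lev u ≤ i ∧ i < lev v) ≤ 2 - lam
  cut_bot : pairSum w (fun u v => lev u ≤ 0 ∧ 0 < lev v) ≤ 1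
  cut_top : pairSum w (fun u v => lev u ≤ k ∧ k < lev v) ≤ 1
  lam_nonneg : 0 ≤ lam
  lam_le_one : lam ≤ 1

section pairSum

variable {w : V → V → ℝ}

lemma pairSum_eq_sum_filter (P : V → V → Prop) :
    pairSum w P = ∑ p : V × V with P p.1 p.2, w p.1 p.2 := by
  rw [pairSum, sum_filter, ← univ_product_univ, sum_product]

lemma pairSum_comm (hs : ∀ u v, w u v = w v u) (P : V → V → Prop) :
    pairSum w P = pairSum w (fun u v => P v u) := by
  unfold pairSum
  rw [sum_comm]
  simp only [hs]

lemma pairSum_mono (h0 : ∀ u v, 0 ≤ w u v) {P Q : V → V → Prop} (h : ∀ u v, P u v → Q u v) :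
    pairSum w P ≤ pairSum w Q := by
  refine sum_le_sum fun u _ => sum_le_sum fun v _ => ?_
  have := h0 u v
  have := h u v
  split_ifs <;> simp_all

lemma pairSum_congr {P Q : V → V → Prop} (h : ∀ u v, P u v ↔ Q u v) :
    pairSum w P = pairSum w Q := by
  simp only [pairSum, h]

lemma pairSum_or {P Q : V → V → Prop} (h : ∀ u v, P u v → ¬ Q u v) :
    pairSum w (fun u v => P u v ∨ Q u v) = pairSum w P + pairSum w Q := by
  simp only [pairSum, ← sum_add_distrib]
  refine sum_congr rfl fun u _ => sum_congr rfl fun v _ => ?_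
  have := h u v
  by_cases hP : P u v <;> by_cases hQ : Q u v <;> simp_all

lemma pairSum_split {P Q R : V → V → Prop} (h : ∀ u v, P u v ↔ Q u v ∨ R u v)
    (h' : ∀ u v, Q u v → ¬ R u v) : pairSum w P = pairSum w Q + pairSum w R := by
  rw [← pairSum_or h', pairSum_congr h]

lemma pairSum_le_add (h0 : ∀ u v, 0 ≤ w u v) {P Q R : V → V → Prop}
    (h : ∀ u v, P u v → Q u v ∨ R u v) : pairSum w P ≤ pairSum w Q + pairSum w R := by
  simp only [pairSum, ← sum_add_distrib]
  refine sum_le_sum fun u _ => sum_le_sum fun v _ => ?_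
  have := h0 u v
  have := h u v
  split_ifs <;> simp_all

lemma pairSum_add_le_add (h0 : ∀ u v, 0 ≤ w u v) {P Q R S : V → V → Prop}
    (hP : ∀ u v, P u v → R u v) (hQ : ∀ u v, Q u v → R u v)
    (hPQ : ∀ u v, P u v → Q u v → S u v) :
    pairSum w P + pairSum w Q ≤ pairSum w R + pairSum w S := by
  simp only [pairSum, ← sum_add_distrib]
  refine sum_le_sum fun u _ => sum_le_sum fun v _ => ?_
  have := h0 u v
  have := hP u v
  have := hQ u v
  have := hPQ u v
  split_ifs <;> simp_all

lemma pairSum_mem (S : Finset V) :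
    pairSum w (fun u v => u ∈ S ∧ v ∈ S) = ∑ u ∈ S, ∑ v ∈ S, w u v := by
  have h (f : V → ℝ) : ∑ u ∈ S, f u = ∑ u, if u ∈ S then f u else 0 := by simp
  simp only [pairSum, h]
  refine sum_congr rfl fun u _ => ?_
  by_cases hu : u ∈ S <;> simp [hu]

/-- A sparse weight puts little weight inside the classes of a labelling. -/
lemma pairSum_classes_le
    (hs : ∀ S : Finset V, S.Nonempty → ∑ u ∈ S, ∑ v ∈ S, w u v ≤ 2 * ((S.card : ℝ) - 1))
    (S : Finset V) (K : V → V) :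
    pairSum w (fun u v => (u ∈ S ∧ v ∈ S) ∧ K u = K v) ≤
      2 * ((S.card : ℝ) - ((S.image K).card : ℝ)) := by
  have h1 : pairSum w (fun u v => (u ∈ S ∧ v ∈ S) ∧ K u = K v) =
      ∑ y ∈ S.image K, ∑ u ∈ S.filter (K · = y), ∑ v ∈ S.filter (K · = y), w u v := by
    simp only [← pairSum_mem]
    simp only [pairSum]
    refine Eq.trans ?_ sum_comm
    refine sum_congr rfl fun u _ => ?_
    refine Eq.trans ?_ sum_comm
    refine sum_congr rfl fun v _ => ?_
    by_cases huv : (u ∈ S ∧ v ∈ S) ∧ K u = K v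
    · rw [if_pos huv, sum_eq_single (K u)]
      · rw [if_pos (by simp [huv])]
      · intro b _ hb
        exact if_neg (by simp; tauto)
      · exact fun h => absurd (mem_image_of_mem K huv.1.1) h
    · rw [if_neg huv]
      refine (sum_eq_zero fun y _ => if_neg fun hy => huv ?_).symm
      simp only [mem_filter] at hy
      exact ⟨⟨hy.1.1, hy.2.1⟩, hy.1.2.trans hy.2.2.symm⟩
  rw [h1, card_eq_sum_card_image K S, card_eq_sum_ones (S.image K)]
  push_cast
  rw [← sum_sub_distrib, mul_sum]
  refine sum_le_sum fun y hy => hs _ ?_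
  obtain ⟨v, hv, rfl⟩ := mem_image.1 hy
  exact ⟨v, by simp [hv]⟩

end pairSum

namespace IsChainWeight

variable {w : V → V → ℝ} {lev : V → ℕ} {k : ℕ} {lam : ℝ} (h : IsChainWeight w lev k lam)
include h

lemma le_deg_add (i : ℕ) (hi : i ≤ k + 1) :
    2 * ((univ.filter fun v => lev v = i).card : ℝ) ≤ pairSum w (fun u _ => lev u = i) +
      (if i = 0 then 1 else 0) + (if i = k + 1 then 1 else 0) := by
  have h1 := h.deg i
  have h2 := h.deg_bot
  have h3 := h.deg_top
  rcases Nat.eq_zero_or_pos i with rfl | h0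
  · rw [if_pos rfl, if_neg (by omega)]; linarith
  rcases Nat.lt_or_ge k i with h4 | h4
  · obtain rfl : i = k + 1 := by omega
    rw [if_pos rfl, if_neg (by omega)]; linarith
  · rw [if_neg (by omega), if_neg (by omega)]; linarith [h1 h0 h4]

/-- One or two consecutive levels carry much weight. -/
lemma le_pairSum_interval {a b : ℕ} (hab : a ≤ b) (hba : b ≤ a + 1) (hb : b ≤ k + 1) :
    2 * (((univ.filter fun v => a ≤ lev v ∧ lev v ≤ b).card : ℝ) - 2 + lam) ≤
      pairSum w (fun u v => (a ≤ lev u ∧ lev u ≤ b) ∧ (a ≤ lev v ∧ lev v ≤ b)) := by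
  have hdeg : 2 * ((univ.filter fun v => a ≤ lev v ∧ lev v ≤ b).card : ℝ) ≤
      pairSum w (fun u _ => a ≤ lev u ∧ lev u ≤ b) + (if a = 0 then 1 else 0) +
        (if b = k + 1 then 1 else 0) := by
    rcases Nat.lt_or_ge a b with h1 | h1
    · obtain rfl : b = a + 1 := by omega
      have e1 : (univ.filter fun v => a ≤ lev v ∧ lev v ≤ a + 1).card =
          (univ.filter fun v => lev v = a).card + (univ.filter fun v => lev v = a + 1).card := by
        rw [← card_union_of_disjoint]
        · congr 1; ext v; simp; omega
        · rw [disjoint_filter]; intro v _; omega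
      have e2 := pairSum_split (w := w) (P := fun u _ => a ≤ lev u ∧ lev u ≤ a + 1)
        (Q := fun u _ => lev u = a) (R := fun u _ => lev u = a + 1)
        (fun u v => by omega) (fun u v => by omega)
      have h2 := h.le_deg_add a (by omega)
      have h3 := h.le_deg_add (a + 1) hb
      rw [e1, e2, Nat.cast_add]
      rw [if_neg (by omega : ¬ a = k + 1)] at h2
      rw [if_neg (by omega : ¬ a + 1 = 0)] at h3
      linarith
    · obtain rfl : b = a := by omega
      have e : ∀ v, b ≤ lev v ∧ lev v ≤ b ↔ lev v = b := fun v => by omega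
      simp only [e]
      exact h.le_deg_add b hb
  have hsplit : pairSum w (fun u _ => a ≤ lev u ∧ lev u ≤ b) =
      pairSum w (fun u v => (a ≤ lev u ∧ lev u ≤ b) ∧ (a ≤ lev v ∧ lev v ≤ b)) +
      (pairSum w (fun u v => (a ≤ lev u ∧ lev u ≤ b) ∧ lev v < a) +
       pairSum w (fun u v => (a ≤ lev u ∧ lev u ≤ b) ∧ b < lev v)) := by
    rw [← pairSum_or (fun u v => by omega), ← pairSum_or (fun u v => by omega)]
    exact pairSum_congr fun u v => by omega
  have hleft : pairSum w (fun u v => (a ≤ lev u ∧ lev u ≤ b) ∧ lev v < a) +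
      (if a = 0 then 1 else 0) ≤ 2 - lam := by
    split_ifs with h0
    · have : pairSum w (fun u v => (a ≤ lev u ∧ lev u ≤ b) ∧ lev v < a) = 0 := by
        simp [pairSum, h0]
      linarith [h.lam_le_one]
    · have := h.cut_le (a - 1) (by omega)
      rw [pairSum_comm h.symm] at this
      have := pairSum_mono h.nonneg (P := fun u v => (a ≤ lev u ∧ lev u ≤ b) ∧ lev v < a)
        (Q := fun u v => lev v ≤ a - 1 ∧ a - 1 < lev u) (fun u v => by omega)
      linarith
  have hright : pairSum w (fun u v => (a ≤ lev u ∧ lev u ≤ b) ∧ b < lev v) +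
      (if b = k + 1 then 1 else 0) ≤ 2 - lam := by
    split_ifs with h0
    · have : pairSum w (fun u v => (a ≤ lev u ∧ lev u ≤ b) ∧ b < lev v) = 0 := by
        simp [pairSum, h0, (Nat.not_lt.2 (h.lev_le _))]
      linarith [h.lam_le_one]
    · have := h.cut_le b (by omega)
      have := pairSum_mono h.nonneg (P := fun u v => (a ≤ lev u ∧ lev u ≤ b) ∧ b < lev v)
        (Q := fun u v => lev u ≤ b ∧ b < lev v) (fun u v => by omega)
      linarith
  linarith

/-- Little weight jumps over a level. -/
lemma pairSum_jump_le {i : ℕ} (hi : 1 ≤ i) :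
    pairSum w (fun u v => lev u < i ∧ i < lev v) ≤ 1 - lam := by
  rcases Nat.lt_or_ge k i with hk | hk
  · have : pairSum w (fun u v => lev u < i ∧ i < lev v) = 0 := by
      have : ∀ v, ¬ i < lev v := fun v => by have := h.lev_le v; omega
      simp [pairSum, this]
    linarith [h.lam_le_one]
  have c1 := h.cut_le (i - 1) (by omega)
  have c2 := h.cut_le i hk
  rw [pairSum_split (Q := fun u v => lev u < i ∧ i < lev v) (R := fun u v => lev u < i ∧ lev v = i)
    (fun u v => by omega) (fun u v => by omega)] at c1
  rw [pairSum_split (Q := fun u v => lev u < i ∧ i < lev v) (R := fun u v => lev u = i ∧ i < lev v)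
    (fun u v => by omega) (fun u v => by omega)] at c2
  rw [pairSum_comm h.symm (fun u v => lev u < i ∧ lev v = i)] at c1
  have hd := h.deg i hi hk
  rw [pairSum_split (Q := fun u v => lev u = i ∧ lev v = i)
    (R := fun u v => (lev v < i ∧ lev u = i) ∨ (lev u = i ∧ i < lev v))
    (fun u v => by omega) (fun u v => by omega), pairSum_or (fun u v => by omega)] at hd
  have hsp := h.sparse (univ.filter fun v => lev v = i)
    (by obtain ⟨v, hv⟩ := h.lev_surj i (by omega); exact ⟨v, by simp [hv]⟩)
  rw [← pairSum_mem] at hsp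
  simp only [mem_filter, mem_univ, true_and] at hsp
  linarith

end IsChainWeight

section merge

/-- A refinement `K` of a labelling `Q`, with the classes of `K` contained in levels. -/
structure IsLevelRefinement (lev : V → ℕ) (K Q : V → V) : Prop where
  lev_eq : ∀ u v, K u = K v → lev u = lev v
  label_eq : ∀ u v, K u = K v → Q u = Q v

/-- The pairs within a class of `K`, or within a class of `Q` and not joining two consecutive
levels separated by a cut outside `F`. -/
def Covered (lev : V → ℕ) (K Q : V → V) (F : Finset ℕ) (u v : V) : Prop :=
  K u = K v ∨ (Q u = Q v ∧ (lev u + 2 ≤ lev v ∨ lev v + 2 ≤ lev u ∨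
    (lev v = lev u + 1 ∧ lev u ∈ F) ∨ (lev u = lev v + 1 ∧ lev v ∈ F)))

/-- The weight of the covered pairs is bounded by the rank formula. -/
def RankBound (w : V → V → ℝ) (lam : ℝ) (lev : V → ℕ) (K Q : V → V) (F : Finset ℕ) : Prop :=
  pairSum w (Covered lev K Q F) ≤
    2 * ((Fintype.card V : ℝ) - lam * ((univ.image K).card : ℝ) + lam * (F.card : ℝ) -
      (1 - lam) * ((univ.image Q).card : ℝ))

variable {w : V → V → ℝ} {lev : V → ℕ} {k : ℕ} {lam : ℝ}

/-- Merging everything inside one or two consecutive levels. -/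
lemma exists_merge {K Q : V → V} {F : Finset ℕ} (h : IsChainWeight w lev k lam)
    (hKQ : IsLevelRefinement lev K Q) (hF : F ⊆ range (k + 1))
    {a b : ℕ} (hab : a ≤ b) (hba : b ≤ a + 1) (hb : b ≤ k + 1) (hFab : Disjoint F (Ico a b))
    (hlt : ((univ.filter fun v => a ≤ lev v ∧ lev v ≤ b).image Q).card <
      ((univ.filter fun v => a ≤ lev v ∧ lev v ≤ b).image K).card) :
    ∃ K' Q' : V → V, ∃ F' : Finset ℕ, IsLevelRefinement lev K' Q' ∧ F' ⊆ range (k + 1) ∧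
      (univ.image K').card + (k + 1 - F'.card) < (univ.image K).card + (k + 1 - F.card) ∧
      (RankBound w lam lev K' Q' F' → RankBound w lam lev K Q F) := by
  set M := univ.filter fun v => a ≤ lev v ∧ lev v ≤ b with hM
  have memM (v : V) : v ∈ M ↔ a ≤ lev v ∧ lev v ≤ b := by simp [hM]
  obtain ⟨v₀, -⟩ := h.lev_surj 0 (by omega)
  have hrep : ∃ rep : ℕ → V, ∀ i ≤ k + 1, lev (rep i) = i := by
    have : Nonempty V := ⟨v₀⟩
    choose! rep hrep using h.lev_surj
    exact ⟨rep, hrep⟩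
  obtain ⟨rep, hrep⟩ := hrep
  set K' : V → V := fun v => if v ∈ M then K (rep (lev v)) else K v with hK'
  set Q' : V → V := fun v => if ∃ u ∈ M, Q u = Q v then Q (rep a) else Q v with hQ'
  have hrepM {i : ℕ} (hi : a ≤ i ∧ i ≤ b) : rep i ∈ M := by
    rw [memM, hrep i (by omega)]; exact hi
  have K'_mem {v : V} (hv : v ∈ M) : K' v = K (rep (lev v)) := if_pos hv
  have K'_not {v : V} (hv : v ∉ M) : K' v = K v := if_neg hv
  have Q'_mem {v : V} (hv : v ∈ M) : Q' v = Q (rep a) := if_pos ⟨v, hv, rfl⟩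
  have Q'_congr {u v : V} (huv : Q u = Q v) : Q' u = Q' v := by simp only [hQ', huv]
  have K'_lev {u v : V} (huv : K' u = K' v) : lev u = lev v := by
    by_cases hu : u ∈ M <;> by_cases hv : v ∈ M
    · rw [K'_mem hu, K'_mem hv] at huv
      have := hKQ.lev_eq _ _ huv
      rwa [hrep _ (h.lev_le u), hrep _ (h.lev_le v)] at this
    · rw [K'_mem hu, K'_not hv] at huv
      have := hKQ.lev_eq _ _ huv
      rwa [hrep _ (h.lev_le u)] at this
    · rw [K'_not hu, K'_mem hv] at huv
      have := hKQ.lev_eq _ _ huv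
      rwa [hrep _ (h.lev_le v)] at this
    · rw [K'_not hu, K'_not hv] at huv
      exact hKQ.lev_eq _ _ huv
  have K'_of_lev {u v : V} (hu : u ∈ M) (huv : lev u = lev v) : K' u = K' v := by
    rw [K'_mem hu, K'_mem ((memM v).2 (huv ▸ (memM u).1 hu)), huv]
  have cardK : (univ.image K).card = (Mᶜ.image K).card + (M.image K).card := by
    rw [← card_union_of_disjoint, ← image_union, union_comm, union_compl]
    rw [disjoint_left]
    intro y hy hy'
    obtain ⟨u, hu, rfl⟩ := mem_image.1 hy
    obtain ⟨v, hv, hvu⟩ := mem_image.1 hy'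
    rw [mem_compl, memM, ← hKQ.lev_eq _ _ hvu, ← memM] at hu
    exact hu hv
  have cardK' : (univ.image K').card = (Mᶜ.image K).card + (b + 1 - a) := by
    have e1 : univ.image K' = Mᶜ.image K ∪ (Icc a b).image (fun i => K (rep i)) := by
      ext y
      simp only [mem_image, mem_univ, true_and, mem_union, mem_compl, mem_Icc]
      constructor
      · rintro ⟨v, rfl⟩
        by_cases hv : v ∈ M
        · exact Or.inr ⟨lev v, (memM v).1 hv, (K'_mem hv).symm⟩
        · exact Or.inl ⟨v, hv, (K'_not hv).symm⟩
      · rintro (⟨v, hv, rfl⟩ | ⟨i, hi, rfl⟩)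
        · exact ⟨v, K'_not hv⟩
        · exact ⟨rep i, by rw [K'_mem (hrepM hi), hrep i (by omega)]⟩
    rw [e1, card_union_of_disjoint, card_image_of_injOn (s := Icc a b), Nat.card_Icc]
    · intro i hi j hj hij
      simp only [coe_Icc, Set.mem_Icc] at hi hj
      have := hKQ.lev_eq _ _ hij
      rwa [hrep i (by omega), hrep j (by omega)] at this
    · rw [disjoint_left]
      intro y hy hy'
      obtain ⟨u, hu, rfl⟩ := mem_image.1 hy
      obtain ⟨i, hi, hiu⟩ := mem_image.1 hy'
      rw [mem_compl, memM, ← hKQ.lev_eq _ _ hiu, ← memM] at hu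
      exact hu (hrepM (mem_Icc.1 hi))
  have cardQ : (univ.image Q).card + 1 ≤ (univ.image Q').card + (M.image Q).card := by
    have e1 : insert (Q (rep a)) (univ.image Q \ M.image Q) ⊆ univ.image Q' := by
      intro y hy
      rcases mem_insert.1 hy with rfl | hy
      · exact mem_image.2 ⟨rep a, mem_univ _, Q'_mem (hrepM ⟨le_rfl, hab⟩)⟩
      · obtain ⟨hy1, hy2⟩ := mem_sdiff.1 hy
        obtain ⟨v, -, rfl⟩ := mem_image.1 hy1
        refine mem_image.2 ⟨v, mem_univ _, if_neg ?_⟩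
        simpa using hy2
    have e2 := card_le_card e1
    rw [card_insert_of_notMem (fun hm => (mem_sdiff.1 hm).2
      (mem_image_of_mem Q (hrepM ⟨le_rfl, hab⟩)))] at e2
    have := card_le_card_sdiff_add_card (s := univ.image Q) (t := M.image Q)
    omega
  have cardF : (F ∪ Ico a b).card = F.card + (b - a) := by
    rw [card_union_of_disjoint hFab, Nat.card_Ico]
  have hF' : F ∪ Ico a b ⊆ range (k + 1) :=
    union_subset hF fun i hi => by simp only [mem_Ico, mem_range] at *; omega
  refine ⟨K', Q', F ∪ Ico a b, ⟨fun u v => K'_lev, fun u v huv => ?_⟩, hF', ?_, fun hR => ?_⟩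
  · by_cases hu : u ∈ M
    · rw [Q'_mem hu, Q'_mem ((memM v).2 (K'_lev huv ▸ (memM u).1 hu))]
    · have hv : v ∉ M := fun hv => hu ((memM u).2 (K'_lev huv ▸ (memM v).1 hv))
      rw [K'_not hu, K'_not hv] at huv
      exact Q'_congr (hKQ.label_eq _ _ huv)
  · have h1 := card_le_card hF'
    rw [cardF, card_range] at h1
    have h2 : 0 < (M.image Q).card := card_pos.2 (image_nonempty.2 ⟨rep a, hrepM ⟨le_rfl, hab⟩⟩)
    rw [cardK, cardK', cardF]
    omega
  · unfold RankBound at hR ⊢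
    have s1 : pairSum w (Covered lev K Q F) + pairSum w (fun u v => u ∈ M ∧ v ∈ M) ≤
        pairSum w (Covered lev K' Q' (F ∪ Ico a b)) +
          pairSum w (fun u v => (u ∈ M ∧ v ∈ M) ∧ K u = K v) := by
      have hKK {u v : V} (huv : K u = K v) : K' u = K' v := by
        have hl := hKQ.lev_eq _ _ huv
        by_cases hu : u ∈ M
        · exact K'_of_lev hu hl
        · have hv : v ∉ M := fun hv => hu ((memM u).2 (hl ▸ (memM v).1 hv))
          rw [K'_not hu, K'_not hv, huv]
      have i1 (u v : V) (huv : Covered lev K Q F u v) : Covered lev K' Q' (F ∪ Ico a b) u v := by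
        rcases huv with huv | ⟨hq, huv⟩
        · exact Or.inl (hKK huv)
        · refine Or.inr ⟨Q'_congr hq, ?_⟩
          simp only [mem_union]
          tauto
      have i2 (u v : V) (huv : u ∈ M ∧ v ∈ M) : Covered lev K' Q' (F ∪ Ico a b) u v := by
        by_cases hl : lev u = lev v
        · exact Or.inl (K'_of_lev huv.1 hl)
        · refine Or.inr ⟨by rw [Q'_mem huv.1, Q'_mem huv.2], ?_⟩
          simp only [memM] at huv
          simp only [mem_union, mem_Ico]
          omega
      have i3 (u v : V) (huv : Covered lev K Q F u v) (hm : u ∈ M ∧ v ∈ M) : K u = K v := by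
        rcases huv with huv | ⟨-, huv⟩
        · exact huv
        · simp only [memM] at hm
          have hd (i : ℕ) (hi : i ∈ F) : ¬ (a ≤ i ∧ i < b) := fun hi' =>
            disjoint_left.1 hFab hi (mem_Ico.2 hi')
          have := hd (lev u)
          have := hd (lev v)
          exfalso
          rcases huv with huv | huv | huv | huv
          · omega
          · omega
          · exact hd _ huv.2 (by omega)
          · exact hd _ huv.2 (by omega)
      exact pairSum_add_le_add h.nonneg i1 i2 fun u v h1 h2 => ⟨h2, i3 u v h1 h2⟩
    have s2 := pairSum_classes_le h.sparse M K
    have s3 := h.le_pairSum_interval hab hba hb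
    simp only [← memM] at s3
    rw [filter_univ_mem] at s3
    have r1 : ((univ.image K).card : ℝ) = (Mᶜ.image K).card + (M.image K).card := by
      exact_mod_cast cardK
    have r2 : ((univ.image K').card : ℝ) = (Mᶜ.image K).card + ((b + 1 - a : ℕ) : ℝ) := by
      exact_mod_cast cardK'
    have r3 : ((univ.image Q).card : ℝ) + 1 ≤ (univ.image Q').card + (M.image Q).card := by
      exact_mod_cast cardQ
    have r4 : ((F ∪ Ico a b).card : ℝ) = F.card + ((b + 1 - a : ℕ) : ℝ) - 1 := by
      rw [cardF, Nat.sub_add_comm hab]; push_cast; ring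
    have r5 : ((M.image Q).card : ℝ) + 1 ≤ (M.image K).card := by exact_mod_cast hlt
    rw [r2, r4] at hR
    rw [r1]
    have := h.lam_le_one
    nlinarith [mul_nonneg (sub_nonneg.2 h.lam_le_one) (sub_nonneg.2 r3),
      mul_nonneg (sub_nonneg.2 h.lam_le_one) (sub_nonneg.2 r5)]

end merge

section drop

variable {w : V → V → ℝ} {lev : V → ℕ} {k : ℕ} {lam : ℝ}

/-- Dropping the `i`-th cut of the chain, which merges the levels `i` and `i + 1`. -/
lemma IsChainWeight.drop (h : IsChainWeight w lev (k + 1) lam) {i : ℕ} (hi : 1 ≤ i) (hik : i ≤ k) :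
    IsChainWeight w (fun v => if lev v ≤ i then lev v else lev v - 1) k lam := by
  have lo (j : ℕ) (hj : j < i) (n : ℕ) : ((if n ≤ i then n else n - 1) = j ↔ n = j) := by
    split_ifs <;> omega
  have mid (n : ℕ) : ((if n ≤ i then n else n - 1) = i ↔ n = i ∨ n = i + 1) := by
    split_ifs <;> omega
  have hi' (j : ℕ) (hj : i < j) (n : ℕ) : ((if n ≤ i then n else n - 1) = j ↔ n = j + 1) := by
    split_ifs <;> omega
  have cut (j : ℕ) (m n : ℕ) : ((if m ≤ i then m else m - 1) ≤ j ∧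
      j < (if n ≤ i then n else n - 1)) ↔
      (m ≤ (if j < i then j else j + 1) ∧ (if j < i then j else j + 1) < n) := by
    split_ifs <;> omega
  refine ⟨h.symm, h.nonneg, h.sparse, fun v => ?_, fun j hj => ?_, fun j hj hjk => ?_, ?_, ?_,
    fun j hj => ?_, ?_, ?_, h.lam_nonneg, h.lam_le_one⟩
  · have := h.lev_le v
    split_ifs <;> omega
  · rcases lt_trichotomy j i with hj' | rfl | hj'
    · obtain ⟨v, hv⟩ := h.lev_surj j (by omega)
      exact ⟨v, (lo j hj' _).2 hv⟩
    · obtain ⟨v, hv⟩ := h.lev_surj j (by omega)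
      exact ⟨v, (mid _).2 (Or.inl hv)⟩
    · obtain ⟨v, hv⟩ := h.lev_surj (j + 1) (by omega)
      exact ⟨v, (hi' j hj' _).2 hv⟩
  · rcases lt_trichotomy j i with hj' | rfl | hj'
    · simp only [lo j hj']
      exact h.deg j hj (by omega)
    · simp only [mid]
      rw [pairSum_or (fun u v => by omega), h.deg j hj (by omega),
        h.deg (j + 1) (by omega) (by omega), filter_or, card_union_of_disjoint]
      · push_cast; ring
      · rw [disjoint_filter]; intro v _; omega
    · simp only [hi' j hj']
      exact h.deg (j + 1) (by omega) (by omega)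
  · simp only [lo 0 hi]
    exact h.deg_bot
  · simp only [hi' (k + 1) (by omega)]
    exact h.deg_top
  · simp only [cut]
    exact h.cut_le _ (by split_ifs <;> omega)
  · simp only [cut, if_pos (show 0 < i by omega)]
    exact h.cut_bot
  · simp only [cut, if_neg (show ¬ k < i by omega)]
    exact h.cut_top

/-- If all `Q`-classes meeting both levels `i` and `i + 1` coincide, then the bound can be deduced
from the bound for the chain without its `i`-th cut. -/
lemma rankBound_of_drop {K Q : V → V} {F : Finset ℕ} (h : IsChainWeight w lev (k + 1) lam)
    (hKQ : IsLevelRefinement lev K Q) (hF : F ⊆ range (k + 2))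
    {i : ℕ} (hi : 1 ≤ i) (hik : i ≤ k) (hiF : i ∈ F)
    {u₁ v₁ : V} (hu₁ : lev u₁ = i) (hv₁ : lev v₁ = i + 1) (huv₁ : Q u₁ = Q v₁)
    (hsame : ∀ u v, lev u = i → lev v = i + 1 → Q u = Q v → K u = K u₁ ∧ K v = K v₁)
    (hdown : ∀ u v, lev u + 1 = i → lev v = i + 1 → Q u = Q v → i - 1 ∈ F)
    (hup : ∀ u v, lev u = i → lev v = i + 2 → Q u = Q v → i + 1 ∈ F)
    (ih : ∀ (lev : V → ℕ) (K Q : V → V) (F : Finset ℕ), IsChainWeight w lev k lam →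
      IsLevelRefinement lev K Q → F ⊆ range (k + 1) → RankBound w lam lev K Q F) :
    RankBound w lam lev K Q F := by
  set lev' : V → ℕ := fun v => if lev v ≤ i then lev v else lev v - 1 with hlev'
  set K' : V → V := fun v => if K v = K v₁ then K u₁ else K v with hK'
  set F' : Finset ℕ := (F.erase i).image (fun j => if j < i then j else j - 1) with hF'
  have memF' (j : ℕ) : j ∈ F' ↔ (j < i ∧ j ∈ F) ∨ (i ≤ j ∧ j + 1 ∈ F) := by
    simp only [hF', mem_image, mem_erase]
    constructor
    · rintro ⟨a, ⟨ha, haF⟩, rfl⟩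
      split_ifs with h1
      · exact Or.inl ⟨h1, haF⟩
      · exact Or.inr ⟨by omega, by rwa [show a - 1 + 1 = a by omega]⟩
    · rintro (⟨h1, h2⟩ | ⟨h1, h2⟩)
      · exact ⟨j, ⟨by omega, h2⟩, if_pos h1⟩
      · exact ⟨j + 1, ⟨by omega, h2⟩, by rw [if_neg (by omega)]; rfl⟩
  have cardF : F'.card + 1 = F.card := by
    rw [hF', card_image_of_injOn, card_erase_add_one hiF]
    intro a ha b hb hab
    simp only [coe_erase, Set.mem_sdiff, Set.mem_singleton_iff] at ha hb
    dsimp only at hab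
    split_ifs at hab <;> omega
  have lev₁ {v : V} (hv : K v = K v₁) : lev v = i + 1 := (hKQ.lev_eq _ _ hv).trans hv₁
  have cardK : (univ.image K).card ≤ (univ.image K').card + 1 := by
    have : univ.image K ⊆ insert (K v₁) (univ.image K') := by
      intro y hy
      obtain ⟨v, -, rfl⟩ := mem_image.1 hy
      by_cases hv : K v = K v₁
      · exact hv ▸ mem_insert_self _ _
      · exact mem_insert_of_mem (mem_image.2 ⟨v, mem_univ _, if_neg hv⟩)
    exact (card_le_card this).trans (card_insert_le _ _)
  have K'_congr {u v : V} (huv : K u = K v) : K' u = K' v := by simp only [hK', huv]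
  have K'_eq {u v : V} (huv : K' u = K' v) : K u = K v ∨
      ((K u = K u₁ ∨ K u = K v₁) ∧ (K v = K u₁ ∨ K v = K v₁)) := by
    simp only [hK'] at huv
    split_ifs at huv with p q q
    · exact Or.inl (p.trans q.symm)
    · exact Or.inr ⟨Or.inr p, Or.inl huv.symm⟩
    · exact Or.inr ⟨Or.inl huv, Or.inr q⟩
    · exact Or.inl huv
  have hlev (u : V) : (lev u ≤ i ∧ lev' u = lev u) ∨ (i < lev u ∧ lev' u + 1 = lev u) := by
    simp only [hlev']
    split_ifs <;> omega
  have hlev₁ {u : V} (hu : K u = K u₁ ∨ K u = K v₁) : lev' u = i ∧ Q u = Q v₁ := by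
    rcases hu with hu | hu
    · have := hKQ.lev_eq _ _ hu
      have := hlev u
      exact ⟨by omega, (hKQ.label_eq _ _ hu).trans huv₁⟩
    · have := lev₁ hu
      have := hlev u
      exact ⟨by omega, hKQ.label_eq _ _ hu⟩
  have key := ih lev' K' Q F' (h.drop hi hik) ⟨fun u v huv => ?_, fun u v huv => ?_⟩ ?_
  · have hcov (u v : V) (huv : Covered lev K Q F u v) : Covered lev' K' Q F' u v := by
      have half (u v : V) (hq : Q u = Q v) (huv : lev u + 2 ≤ lev v ∨
          (lev v = lev u + 1 ∧ lev u ∈ F)) : K' u = K' v ∨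
          (lev' u + 2 ≤ lev' v ∨ (lev' v = lev' u + 1 ∧ lev' u ∈ F')) := by
        have h1 := hlev u
        have h2 := hlev v
        rcases huv with huv | ⟨huv, huF⟩
        · by_cases h3 : lev' u + 2 ≤ lev' v
          · exact Or.inr (Or.inl h3)
          · refine Or.inr (Or.inr ⟨by omega, (memF' _).2 ?_⟩)
            by_cases h4 : lev u < i
            · refine Or.inl ⟨by omega, ?_⟩
              have := hdown u v (by omega) (by omega) hq
              rwa [show lev' u = i - 1 by omega]
            · refine Or.inr ⟨by omega, ?_⟩
              have := hup u v (by omega) (by omega) hq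
              rwa [show lev' u = i by omega]
        · rcases lt_trichotomy (lev u) i with h3 | h3 | h3
          · exact Or.inr (Or.inr ⟨by omega, (memF' _).2 (Or.inl ⟨by omega, by
              rwa [show lev' u = lev u by omega]⟩)⟩)
          · obtain ⟨h4, h5⟩ := hsame u v h3 (by omega) hq
            refine Or.inl ?_
            have h6 : K u ≠ K v₁ := fun hu => by have := lev₁ hu; omega
            simp only [hK', if_pos h5, if_neg h6, h4]
          · exact Or.inr (Or.inr ⟨by omega, (memF' _).2 (Or.inr ⟨by omega, by
              rwa [show lev' u + 1 = lev u by omega]⟩)⟩)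
      rcases huv with huv | ⟨hq, huv⟩
      · exact Or.inl (K'_congr huv)
      · have h1 := half u v hq
        have h2 := half v u hq.symm
        unfold Covered
        rw [eq_comm (a := K' v)] at h2
        tauto
    unfold RankBound at key ⊢
    have h1 := pairSum_mono h.nonneg hcov
    have h2 : (F'.card : ℝ) + 1 = F.card := by exact_mod_cast cardF
    have h3 : ((univ.image K).card : ℝ) ≤ (univ.image K').card + 1 := by exact_mod_cast cardK
    rw [← h2]
    nlinarith [mul_nonneg h.lam_nonneg (sub_nonneg.2 h3)]
  · rcases K'_eq huv with huv | ⟨hu, hv⟩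
    · simp only [hlev', hKQ.lev_eq _ _ huv]
    · rw [(hlev₁ hu).1, (hlev₁ hv).1]
  · rcases K'_eq huv with huv | ⟨hu, hv⟩
    · exact hKQ.label_eq _ _ huv
    · rw [(hlev₁ hu).2, (hlev₁ hv).2]
  · intro j hj
    rcases (memF' j).1 hj with hj | hj
    · exact mem_range.2 (by omega)
    · have := mem_range.1 (hF hj.2)
      exact mem_range.2 (by omega)

end drop

section rankBound

variable {w : V → V → ℝ} {lev : V → ℕ} {k : ℕ} {lam : ℝ}

lemma sum_range_nonneg_of_pairs {n : ℕ} {s : ℕ → ℝ}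
    (hs : ∀ i < n, 0 ≤ s i ∨ (1 ≤ i ∧ 0 ≤ s (i - 1) + s i)) : 0 ≤ ∑ i ∈ range n, s i := by
  suffices ∀ m ≤ n, 0 ≤ ∑ i ∈ range m, s i from this n le_rfl
  intro m
  induction m using Nat.strong_induction_on with
  | _ m ih =>
    intro hm
    rcases m with _ | m
    · simp
    rw [sum_range_succ]
    rcases hs m (by omega) with h | ⟨h1, h⟩
    · exact add_nonneg (ih m (by omega) (by omega)) h
    · obtain ⟨l, rfl⟩ : ∃ l, m = l + 1 := ⟨m - 1, by omega⟩
      rw [sum_range_succ]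
      have := ih l (by omega) (by omega)
      simp only [Nat.add_sub_cancel] at h
      linarith

section labels

variable {α : Type*} {K Q : α → α}

lemma exists_comp_eq (hKQ : ∀ u v, K u = K v → Q u = Q v) : ∃ g : α → α, ∀ v, g (K v) = Q v := by
  refine ⟨fun y => if hy : ∃ v, K v = y then Q hy.choose else y, fun v => ?_⟩
  have hy : ∃ u, K u = K v := ⟨v, rfl⟩
  exact (dif_pos hy).trans (hKQ _ _ hy.choose_spec)

lemma card_image_le_of_refines (hKQ : ∀ u v, K u = K v → Q u = Q v) (S : Finset α) :
    (S.image Q).card ≤ (S.image K).card := by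
  obtain ⟨g, hg⟩ := exists_comp_eq hKQ
  rw [show S.image Q = (S.image K).image g by simp [image_image, Function.comp_def, hg]]
  exact card_image_le

lemma eq_of_card_image_le (hKQ : ∀ u v, K u = K v → Q u = Q v) {S : Finset α}
    (hS : (S.image K).card ≤ (S.image Q).card) {u v : α} (hu : u ∈ S) (hv : v ∈ S)
    (huv : Q u = Q v) : K u = K v := by
  obtain ⟨g, hg⟩ := exists_comp_eq hKQ
  have h1 : S.image Q = (S.image K).image g := by simp [image_image, Function.comp_def, hg]
  rw [h1] at hS
  have h2 := card_image_iff.1 (le_antisymm card_image_le hS)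
  exact h2 (mem_coe.2 (mem_image_of_mem K hu)) (mem_coe.2 (mem_image_of_mem K hv))
    (by rw [hg, hg, huv])

end labels

/-- The `Q`-classes meeting both level `i` and some higher level. -/
noncomputable def crossingClasses (lev : V → ℕ) (Q : V → V) (i : ℕ) : Finset V :=
  (univ.filter fun v => lev v = i).image Q ∩ (univ.filter fun v => i < lev v).image Q

lemma mem_crossingClasses {Q : V → V} {i : ℕ} {u v : V} (hu : lev u = i) (hv : i < lev v)
    (huv : Q u = Q v) : Q u ∈ crossingClasses lev Q i :=
  mem_inter.2 ⟨mem_image_of_mem Q (by simp [hu]), huv ▸ mem_image_of_mem Q (by simp [hv])⟩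

lemma sum_card_crossingClasses_le {K Q : V → V} (hKQ : IsLevelRefinement lev K Q)
    (hlev : ∀ v, lev v ≤ k + 1) :
    ∑ i ∈ range (k + 1), (crossingClasses lev Q i).card + (univ.image Q).card ≤
      (univ.image K).card := by
  have h1 : ∑ i ∈ range (k + 2), ((univ.filter fun v => lev v = i).image K).card ≤
      (univ.image K).card := by
    rw [← card_biUnion]
    · exact card_le_card (biUnion_subset.2 fun i _ => image_subset_image (subset_univ _))
    · intro i _ j _ hij
      rw [Function.onFun, disjoint_left]
      intro y hy hy'
      obtain ⟨u, hu, rfl⟩ := mem_image.1 hy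
      obtain ⟨v, hv, hvu⟩ := mem_image.1 hy'
      rw [mem_filter] at hu hv
      exact hij (hu.2.symm.trans ((hKQ.lev_eq _ _ hvu).symm.trans hv.2))
  have h2 : (univ.image Q).card ≤ ∑ i ∈ range (k + 2),
      ((univ.filter fun v => lev v = i).image Q \ (univ.filter fun v => i < lev v).image Q).card := by
    refine le_trans (card_le_card fun y hy => ?_) card_biUnion_le
    obtain ⟨v₀, -, hv₀⟩ := mem_image.1 hy
    obtain ⟨v, hv, hmax⟩ := exists_max_image (univ.filter fun v => Q v = y) lev
      ⟨v₀, by simp [hv₀]⟩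
    have hv := (mem_filter.1 hv).2
    refine mem_biUnion.2 ⟨lev v, mem_range.2 (by have := hlev v; omega), mem_sdiff.2 ⟨?_, ?_⟩⟩
    · exact mem_image.2 ⟨v, by simp, hv⟩
    · intro hy'
      obtain ⟨u, hu, huy⟩ := mem_image.1 hy'
      have := hmax u (by simp [huy])
      have := (mem_filter.1 hu).2
      omega
  have h3 : ∑ i ∈ range (k + 1), (crossingClasses lev Q i).card ≤
      ∑ i ∈ range (k + 2), (crossingClasses lev Q i).card :=
    sum_le_sum_of_subset (range_subset_range.2 (by omega))
  have h4 : ∑ i ∈ range (k + 2), (crossingClasses lev Q i).card + ∑ i ∈ range (k + 2),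
      ((univ.filter fun v => lev v = i).image Q \ (univ.filter fun v => i < lev v).image Q).card ≤
      ∑ i ∈ range (k + 2), ((univ.filter fun v => lev v = i).image K).card := by
    rw [← sum_add_distrib]
    refine sum_le_sum fun i _ => ?_
    rw [crossingClasses, card_inter_add_card_sdiff]
    exact card_image_le_of_refines hKQ.label_eq _
  omega

lemma pairSum_lt_eq_sum (hlev : ∀ v, lev v ≤ k + 1) (P : V → V → Prop) :
    pairSum w (fun u v => lev u < lev v ∧ P u v) =
      ∑ i ∈ range (k + 1), pairSum w (fun u v => (lev u = i ∧ i < lev v) ∧ P u v) := by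
  simp only [pairSum]
  refine Eq.trans ?_ sum_comm
  refine sum_congr rfl fun u _ => ?_
  refine Eq.trans ?_ sum_comm
  refine sum_congr rfl fun v _ => ?_
  by_cases huv : lev u < lev v ∧ P u v
  · have := hlev v
    rw [if_pos huv, sum_eq_single (lev u)]
    · simp [huv]
    · intro i _ hi
      exact if_neg fun hc => hi hc.1.1.symm
    · exact fun hc => absurd (mem_range.2 (by omega)) hc
  · rw [if_neg huv]
    refine (sum_eq_zero fun i _ => if_neg fun hc => huv ⟨?_, hc.2⟩).symm
    omega

/-- The bound holds, by induction on the chain, when no merging step is possible. -/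
lemma rankBound_of_no_merge {K Q : V → V} {F : Finset ℕ} (h : IsChainWeight w lev k lam)
    (hKQ : IsLevelRefinement lev K Q) (hF : F ⊆ range (k + 1))
    (hmerge : ∀ a b, a ≤ b → b ≤ a + 1 → b ≤ k + 1 → Disjoint F (Ico a b) →
      ((univ.filter fun v => a ≤ lev v ∧ lev v ≤ b).image K).card ≤
      ((univ.filter fun v => a ≤ lev v ∧ lev v ≤ b).image Q).card)
    (ih : ∀ l, k = l + 1 → ∀ (lev : V → ℕ) (K Q : V → V) (F : Finset ℕ),
      IsChainWeight w lev l lam → IsLevelRefinement lev K Q → F ⊆ range (l + 1) →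
      RankBound w lam lev K Q F) :
    RankBound w lam lev K Q F := by
  by_contra hR
  have hinj {u v : V} (huv : lev u = lev v) (hq : Q u = Q v) : K u = K v :=
    eq_of_card_image_le hKQ.label_eq
      (hmerge (lev u) (lev u) le_rfl (by omega) (h.lev_le u) (by simp)) (by simp)
      (by simp [huv]) hq
  have hno {u v : V} (huv : lev v = lev u + 1) (hq : Q u = Q v) : lev u ∈ F := by
    by_contra hu
    have := eq_of_card_image_le hKQ.label_eq
      (hmerge (lev u) (lev u + 1) (by omega) le_rfl (huv ▸ h.lev_le v) (by simp [hu]))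
      (u := u) (v := v) (by simp) (by simp [huv]) hq
    have := hKQ.lev_eq _ _ this
    omega
  set up : ℕ → ℝ := fun i =>
    pairSum w (fun u v => (lev u = i ∧ i < lev v) ∧ Covered lev K Q F u v) with hup
  have cov_label {u v : V} (huv : Covered lev K Q F u v) : Q u = Q v :=
    huv.elim (hKQ.label_eq _ _) And.left
  have cov_mem {u v : V} (huv : Covered lev K Q F u v) (h1 : lev v = lev u + 1) : lev u ∈ F := by
    rcases huv with huv | ⟨-, huv⟩
    · have := hKQ.lev_eq _ _ huv
      omega
    · rcases huv with huv | huv | huv | huv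
      · omega
      · omega
      · exact huv.2
      · omega
  have up_le_cut (i : ℕ) : up i ≤ pairSum w (fun u v => lev u ≤ i ∧ i < lev v) :=
    pairSum_mono h.nonneg fun u v huv => ⟨huv.1.1.le, huv.1.2⟩
  have up_jump {i : ℕ} (hi : ∀ u v, lev u = i → lev v = i + 1 → Q u = Q v → i ∉ F) :
      up i ≤ 1 - lam := by
    refine (pairSum_mono h.nonneg fun u v huv => ?_).trans (h.pairSum_jump_le (i := i + 1) (by omega))
    refine ⟨by omega, ?_⟩
    by_contra hv
    have hv' : lev v = i + 1 := by omega
    exact hi u v huv.1.1 hv' (cov_label huv.2)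
      (huv.1.1 ▸ cov_mem huv.2 (by omega))
  have up_zero {i : ℕ} (hi : (crossingClasses lev Q i).card = 0) : up i ≤ 0 := by
    have hP (u v : V) : ¬ ((lev u = i ∧ i < lev v) ∧ Covered lev K Q F u v) := fun huv => by
      have := mem_crossingClasses huv.1.1 huv.1.2 (cov_label huv.2)
      rw [card_eq_zero.1 hi] at this
      exact absurd this (notMem_empty _)
    simp [hup, pairSum, hP]
  have l0 := h.lam_nonneg
  have l1 := h.lam_le_one
  have easy {i : ℕ} (hi : ∀ u v, lev u = i → lev v = i + 1 → Q u = Q v → i ∉ F) :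
      up i ≤ (1 - lam) * (crossingClasses lev Q i).card := by
    rcases Nat.eq_zero_or_pos (crossingClasses lev Q i).card with h0 | h0
    · rw [h0]; simpa using up_zero h0
    · have : (1 : ℝ) ≤ (crossingClasses lev Q i).card := by exact_mod_cast h0
      have := up_jump hi
      nlinarith
  have main : 0 ≤ ∑ i ∈ range (k + 1), (lam * (if i ∈ F then 1 else 0) +
      (1 - lam) * (crossingClasses lev Q i).card - up i) := by
    refine sum_range_nonneg_of_pairs fun i hi => ?_
    by_cases hC : ∀ u v, lev u = i → lev v = i + 1 → Q u = Q v → i ∉ F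
    · left
      have := easy hC
      split_ifs <;> linarith
    push Not at hC
    obtain ⟨u₁, v₁, hu₁, hv₁, huv₁, hiF⟩ := hC
    have hm₁ := mem_crossingClasses hu₁ (by omega : i < lev v₁) huv₁
    have hpos : 0 < (crossingClasses lev Q i).card := card_pos.2 ⟨_, hm₁⟩
    rw [if_pos hiF]
    rcases Nat.lt_or_ge 1 (crossingClasses lev Q i).card with h2 | h2
    · left
      have : (2 : ℝ) ≤ (crossingClasses lev Q i).card := by exact_mod_cast h2
      have := up_le_cut i
      have := h.cut_le i (by omega)
      nlinarith
    have hone : (crossingClasses lev Q i).card = 1 := by omega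
    rw [hone]
    have huniq {u v : V} (hu : lev u = i) (hv : i < lev v) (huv : Q u = Q v) : Q u = Q u₁ :=
      card_le_one.1 h2 _ (mem_crossingClasses hu hv huv) _ hm₁
    rcases Nat.eq_zero_or_pos i with rfl | hi0
    · left
      have := up_le_cut 0
      have := h.cut_bot
      push_cast; linarith
    rcases Nat.lt_or_ge i k with hik | hik
    swap
    · left
      obtain rfl : i = k := by omega
      have := up_le_cut i
      have := h.cut_top
      push_cast; linarith
    by_cases hD : i - 1 ∉ F ∧ ∃ u v, lev u + 1 = i ∧ lev v = i + 1 ∧ Q u = Q v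
    · right
      refine ⟨hi0, ?_⟩
      obtain ⟨hF1, u, v, hu, hv, huv⟩ := hD
      have hm := mem_crossingClasses (lev := lev) (i := i - 1) (u := u) (v := v)
        (by omega) (by omega) huv
      have h3 : (1 : ℝ) ≤ (crossingClasses lev Q (i - 1)).card := by
        exact_mod_cast card_pos.2 ⟨_, hm⟩
      have h4 : up (i - 1) + up i ≤ pairSum w (fun u v => lev u ≤ i ∧ i < lev v) := by
        simp only [hup]
        rw [← pairSum_or (fun u v => by omega)]
        refine pairSum_mono h.nonneg fun u v huv => ?_
        rcases huv with huv | huv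
        · refine ⟨by omega, ?_⟩
          by_contra hv
          refine hF1 ?_
          rw [← huv.1.1]
          exact cov_mem huv.2 (by omega)
        · omega
      have := h.cut_le i (by omega)
      rw [if_neg hF1]
      push_cast
      nlinarith
    · exfalso
      push Not at hD
      obtain ⟨l, rfl⟩ : ∃ l, k = l + 1 := ⟨k - 1, by omega⟩
      refine hR (rankBound_of_drop h hKQ hF hi0 (by omega) hiF hu₁ hv₁ huv₁ ?_ ?_ ?_ (ih l rfl))
      · intro u v hu hv huv
        have := huniq hu (by omega) huv
        exact ⟨hinj (by omega) this, hinj (by omega) (by rw [← huv, this, huv₁])⟩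
      · intro u v hu hv huv
        by_contra hF1
        exact hD hF1 u v hu hv huv
      · intro u v hu hv huv
        have := huniq hu (by omega) huv
        rw [← hv₁]
        exact hno (v := v) (by omega) (by rw [← huv, this, huv₁])
  have s1 : pairSum w (Covered lev K Q F) ≤ pairSum w (fun u v => K u = K v) +
      2 * ∑ i ∈ range (k + 1), up i := by
    rw [← pairSum_lt_eq_sum h.lev_le, two_mul, ← add_assoc]
    have e1 := pairSum_comm h.symm (fun u v => lev u < lev v ∧ Covered lev K Q F u v)
    nth_rw 2 [e1]
    have e2 : pairSum w (Covered lev K Q F) ≤ pairSum w (fun u v => K u = K v ∨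
        (lev u < lev v ∧ Covered lev K Q F u v)) +
        pairSum w (fun u v => lev v < lev u ∧ Covered lev K Q F v u) := by
      refine pairSum_le_add h.nonneg fun u v huv => ?_
      have hs : Covered lev K Q F v u := by
        unfold Covered at huv ⊢
        rw [eq_comm (a := K v), eq_comm (a := Q v)]
        tauto
      rcases lt_trichotomy (lev u) (lev v) with hl | hl | hl
      · exact Or.inl (Or.inr ⟨hl, huv⟩)
      · exact Or.inl (Or.inl (hinj hl (cov_label huv)))
      · exact Or.inr ⟨hl, hs⟩
    have e3 : pairSum w (fun u v => K u = K v ∨ (lev u < lev v ∧ Covered lev K Q F u v)) ≤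
        pairSum w (fun u v => K u = K v) +
          pairSum w (fun u v => lev u < lev v ∧ Covered lev K Q F u v) :=
      pairSum_le_add h.nonneg fun u v huv => huv
    linarith
  have s2 := pairSum_classes_le h.sparse univ K
  simp only [mem_univ, true_and] at s2
  rw [card_univ] at s2
  have s3 : (∑ i ∈ range (k + 1), ((crossingClasses lev Q i).card : ℝ)) + (univ.image Q).card ≤
      (univ.image K).card := by
    exact_mod_cast sum_card_crossingClasses_le hKQ h.lev_le
  have s4 : ∑ i ∈ range (k + 1), (if i ∈ F then (1 : ℝ) else 0) = F.card := by
    rw [sum_boole, filter_mem_eq_inter, inter_eq_right.2 hF]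
  rw [sum_sub_distrib, sum_add_distrib, ← mul_sum, ← mul_sum, s4] at main
  refine hR ?_
  unfold RankBound
  nlinarith [mul_nonneg (sub_nonneg.2 l1) (sub_nonneg.2 s3)]

/-- The main inequality for chain weights. -/
theorem IsChainWeight.rankBound : ∀ {k : ℕ} {lev : V → ℕ} {K Q : V → V} {F : Finset ℕ},
    IsChainWeight w lev k lam → IsLevelRefinement lev K Q → F ⊆ range (k + 1) →
    RankBound w lam lev K Q F := by
  intro k
  induction k using Nat.strong_induction_on with
  | _ k ihk =>
    intro lev K Q F h hKQ hF
    induction hm : (univ.image K).card + (k + 1 - F.card) using Nat.strong_induction_on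
      generalizing K Q F with
    | _ m ihm =>
      by_cases hmerge : ∃ a b, a ≤ b ∧ b ≤ a + 1 ∧ b ≤ k + 1 ∧ Disjoint F (Ico a b) ∧
          ((univ.filter fun v => a ≤ lev v ∧ lev v ≤ b).image Q).card <
          ((univ.filter fun v => a ≤ lev v ∧ lev v ≤ b).image K).card
      · obtain ⟨a, b, hab, hba, hb, hFab, hlt⟩ := hmerge
        obtain ⟨K', Q', F', hKQ', hF', hlt', himp⟩ := exists_merge h hKQ hF hab hba hb hFab hlt
        exact himp (ihm _ (hm ▸ hlt') hKQ' hF' rfl)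
      · push Not at hmerge
        refine rankBound_of_no_merge h hKQ hF hmerge ?_
        rintro l rfl lev K Q F h hKQ hF
        exact ihk l (by omega) h hKQ hF

end rankBound

section polytope

variable {G : SimpleGraph V} {x : Sym2 V → ℝ}

lemma SimpleGraph.IsTree.sum_adj [Nonempty V] {H : SimpleGraph V} (hH : H.IsTree) :
    ∑ u, ∑ v, (if H.Adj u v then (1 : ℝ) else 0) = 2 * ((Fintype.card V : ℝ) - 1) := by
  have h1 := H.two_mul_card_edgeFinset
  have h2 := hH.card_edgeFinset
  have h3 : ∑ u, ∑ v, (if H.Adj u v then (1 : ℝ) else 0) =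
      ((univ.filter fun p : V × V => H.Adj p.1 p.2).card : ℝ) := by
    rw [← sum_product', univ_product_univ, sum_boole]
  rw [h3, ← h2]
  push_cast
  have h4 : ((univ.filter fun p : V × V => H.Adj p.1 p.2).card) = 2 * H.edgeFinset.card := by
    rw [h1]
  rw [h4]
  push_cast
  ring

lemma SimpleGraph.IsAcyclic.sum_adj_le [Nonempty V] {H : SimpleGraph V} (hH : H.IsAcyclic) :
    ∑ u, ∑ v, (if H.Adj u v then (1 : ℝ) else 0) ≤ 2 * ((Fintype.card V : ℝ) - 1) := by
  obtain ⟨T, hHT, -, hT⟩ :=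
    (SimpleGraph.connected_top (V := V)).exists_isTree_le_of_le_of_isAcyclic le_top hH
  rw [← hT.sum_adj]
  refine sum_le_sum fun u _ => sum_le_sum fun v _ => ?_
  have := @hHT u v
  split_ifs <;> simp_all

omit [Fintype V] in
lemma SimpleGraph.IsAcyclic.sum_adj_mem_le {H : SimpleGraph V} (hH : H.IsAcyclic) {S : Finset V}
    (hS : S.Nonempty) :
    ∑ u ∈ S, ∑ v ∈ S, (if H.Adj u v then (1 : ℝ) else 0) ≤ 2 * ((S.card : ℝ) - 1) := by
  have : Nonempty ({v | v ∈ S} : Set V) := hS.to_subtype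
  have h1 := (hH.induce {v | v ∈ S}).sum_adj_le
  rw [show (Fintype.card ({v | v ∈ S} : Set V) : ℝ) = S.card by simp] at h1
  simp only [SimpleGraph.comap_adj, Function.Embedding.subtype_apply] at h1
  refine le_trans (le_of_eq ?_) h1
  rw [← sum_coe_sort S]
  refine sum_congr rfl fun u _ => ?_
  rw [← sum_coe_sort S]
  rfl

omit [Fintype V] in
lemma IsSpanningTree.chi_mk {T : Finset (Sym2 V)} (hT : IsSpanningTree G T) (u v : V) :
    chi T s(u, v) =
      if (SimpleGraph.fromEdgeSet (T : Set (Sym2 V))).Adj u v then 1 else 0 := by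
  have h : s(u, v) ∈ T → u ≠ v := fun h => ((hT.1 (mem_coe.2 h) : G.Adj u v)).ne
  simp only [chi, SimpleGraph.fromEdgeSet_adj, mem_coe]
  by_cases h1 : s(u, v) ∈ T
  · simp [h1, h h1]
  · simp [h1]

omit [Fintype V] in
/-- A linear inequality holds on the spanning tree polytope if it holds for spanning trees. -/
lemma le_of_mem_spanningTreePolytope (hx : x ∈ spanningTreePolytope G)
    (f : (Sym2 V → ℝ) →ₗ[ℝ] ℝ) {c : ℝ} (hf : ∀ T, IsSpanningTree G T → f (chi T) ≤ c) :
    f x ≤ c := by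
  have h : spanningTreePolytope G ⊆ {y | f y ≤ c} := by
    refine convexHull_min ?_ (convex_halfSpace_le f.isLinear c)
    rintro y ⟨T, hT, rfl⟩
    exact hf T hT
  exact h hx

variable (hx : x ∈ spanningTreePolytope G)
include hx

omit [Fintype V] in
lemma spanningTreePolytope_nonneg (e : Sym2 V) : 0 ≤ x e := by
  have := le_of_mem_spanningTreePolytope hx (-LinearMap.proj e) (c := 0) fun T _ => by
    simp only [LinearMap.neg_apply, LinearMap.proj_apply, chi]
    split_ifs <;> norm_num
  simpa using this

omit [Fintype V] in
lemma spanningTreePolytope_eq_zero {e : Sym2 V} (he : e ∉ G.edgeSet) : x e = 0 := by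
  refine le_antisymm ?_ (spanningTreePolytope_nonneg hx e)
  exact le_of_mem_spanningTreePolytope hx (LinearMap.proj e) (c := 0) fun T hT => by
    simp only [LinearMap.proj_apply, chi]
    rw [if_neg fun h => he (hT.1 (mem_coe.2 h))]

omit [Fintype V] in
lemma spanningTreePolytope_sum_mem_le {S : Finset V} (hS : S.Nonempty) :
    ∑ u ∈ S, ∑ v ∈ S, x s(u, v) ≤ 2 * ((S.card : ℝ) - 1) := by
  have := le_of_mem_spanningTreePolytope hx (∑ u ∈ S, ∑ v ∈ S, LinearMap.proj s(u, v))
    (c := 2 * ((S.card : ℝ) - 1)) fun T hT => by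
      simp only [LinearMap.sum_apply, LinearMap.proj_apply, hT.chi_mk]
      convert hT.2.isAcyclic.sum_adj_mem_le hS
  simpa using this

lemma spanningTreePolytope_sum [Nonempty V] :
    ∑ u, ∑ v, x s(u, v) = 2 * ((Fintype.card V : ℝ) - 1) := by
  refine le_antisymm ?_ ?_
  · simpa using spanningTreePolytope_sum_mem_le hx (univ_nonempty (α := V))
  · have := le_of_mem_spanningTreePolytope hx (-∑ u, ∑ v, LinearMap.proj s(u, v))
      (c := -(2 * ((Fintype.card V : ℝ) - 1))) fun T hT => by
        simp only [LinearMap.neg_apply, LinearMap.sum_apply, LinearMap.proj_apply, hT.chi_mk]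
        refine neg_le_neg (le_of_eq ?_)
        convert hT.2.sum_adj.symm
    simpa using this

omit hx in
lemma mem_cut {S : Finset V} {e : Sym2 V} :
    e ∈ cut G S ↔ ∃ u v, e = s(u, v) ∧ G.Adj u v ∧ u ∈ S ∧ v ∉ S := by
  simp only [cut, cutBetween, mem_filter, SimpleGraph.mem_edgeFinset, mem_compl]
  constructor
  · rintro ⟨he, u, v, rfl, hu, hv⟩
    exact ⟨u, v, rfl, he, hu, hv⟩
  · rintro ⟨u, v, rfl, h, hu, hv⟩
    exact ⟨h, u, v, rfl, hu, hv⟩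

lemma sum_cut_s12 (S : Finset V) :
    ∑ e ∈ cut G S, x e = pairSum (fun u v => x s(u, v)) (fun u v => u ∈ S ∧ v ∉ S) := by
  have h1 : cut G S = ((S ×ˢ Sᶜ).filter fun p : V × V => G.Adj p.1 p.2).image
      fun p => s(p.1, p.2) := by
    ext e
    simp only [mem_cut, mem_image, mem_filter, mem_product, mem_compl, Prod.exists]
    constructor
    · rintro ⟨u, v, rfl, h⟩
      exact ⟨u, v, by tauto, rfl⟩
    · rintro ⟨u, v, h, rfl⟩
      exact ⟨u, v, rfl, by tauto⟩
  have h2 : pairSum (fun u v => x s(u, v)) (fun u v => u ∈ S ∧ v ∉ S) =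
      ∑ p ∈ S ×ˢ Sᶜ, x s(p.1, p.2) := by
    rw [pairSum_eq_sum_filter]
    congr 1
    ext p
    simp
  rw [h1, h2, sum_image, sum_filter]
  · refine sum_congr rfl fun p _ => ?_
    split_ifs with h
    · rfl
    · exact (spanningTreePolytope_eq_zero hx h).symm
  · rintro ⟨a, b⟩ hp ⟨c, d⟩ hq h
    simp only [coe_filter, mem_product, mem_compl, Set.mem_ofPred_eq] at hp hq
    rcases Sym2.eq_iff.1 h with ⟨rfl, rfl⟩ | ⟨rfl, rfl⟩
    · rfl
    · tauto

omit hx in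
lemma two_mul_sum_edges {X : Finset (Sym2 V)} (hX : (X : Set (Sym2 V)) ⊆ G.edgeSet) :
    2 * ∑ e ∈ X, x e = pairSum (fun u v => x s(u, v)) (fun u v => s(u, v) ∈ X) := by
  have h2 : pairSum (fun u v => x s(u, v)) (fun u v => s(u, v) ∈ X) =
      ∑ p : V × V with s(p.1, p.2) ∈ X, x s(p.1, p.2) := by
    rw [pairSum_eq_sum_filter]
    congr!
  rw [h2, ← sum_fiberwise_of_maps_to (t := X) (g := fun p : V × V => s(p.1, p.2))
    (fun p hp => (mem_filter.1 hp).2), mul_sum]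
  refine sum_congr rfl fun e he => ?_
  induction e with
  | _ a b =>
    have hab : a ≠ b := (hX (mem_coe.2 he) : G.Adj a b).ne
    have h3 : ((univ.filter fun p : V × V => s(p.1, p.2) ∈ X).filter
        fun p => s(p.1, p.2) = s(a, b)) = {(a, b), (b, a)} := by
      ext ⟨c, d⟩
      simp only [mem_filter, mem_univ, true_and, mem_insert, mem_singleton, Prod.mk.injEq,
        Sym2.eq_iff]
      constructor
      · exact fun h => h.2
      · rintro (⟨rfl, rfl⟩ | ⟨rfl, rfl⟩)
        · exact ⟨he, Or.inl ⟨rfl, rfl⟩⟩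
        · exact ⟨Sym2.eq_swap ▸ he, Or.inr ⟨rfl, rfl⟩⟩
    rw [h3, sum_pair (by simp [hab])]
    simp only [Sym2.eq_swap (a := b)]
    ring

end polytope

section levels

/-- `lev` sends each vertex to the index of its level in the chain `Vc 0 ⊂ … ⊂ Vc k`. -/
structure IsLevelMap (Vc : ℕ → Finset V) (k : ℕ) (lev : V → ℕ) : Prop where
  lev_le : ∀ v, lev v ≤ k + 1
  mem_iff : ∀ i ≤ k, ∀ v, v ∈ Vc i ↔ lev v ≤ i
  surj : ∀ i ≤ k + 1, ∃ v, lev v = i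

lemma exists_isLevelMap {Vc : ℕ → Finset V} {k : ℕ} (hne : (Vc 0).Nonempty)
    (hchain : ∀ i < k, Vc i ⊂ Vc (i + 1)) (htop : Vc k ⊂ univ) : ∃ lev, IsLevelMap Vc k lev := by
  have hmono {i j : ℕ} (hij : i ≤ j) (hj : j ≤ k) : Vc i ⊆ Vc j := by
    induction j, hij using Nat.le_induction with
    | base => exact subset_rfl
    | succ j hij ih => exact (ih (by omega)).trans (hchain j (by omega)).subset
  set lev : V → ℕ := fun v => sInf {i | v ∈ Vc i ∨ k < i} with hlev
  have hspec (v : V) : v ∈ Vc (lev v) ∨ k < lev v :=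
    Nat.sInf_mem (s := {i | v ∈ Vc i ∨ k < i}) ⟨k + 1, Or.inr (Nat.lt_succ_self k)⟩
  have hle (v : V) (i : ℕ) (hi : v ∈ Vc i ∨ k < i) : lev v ≤ i := Nat.sInf_le hi
  have hmem (i : ℕ) (hi : i ≤ k) (v : V) : v ∈ Vc i ↔ lev v ≤ i := by
    refine ⟨fun hv => hle v i (Or.inl hv), fun hv => ?_⟩
    exact hmono hv hi ((hspec v).resolve_right (by omega))
  have hlev_le (v : V) : lev v ≤ k + 1 := hle v _ (Or.inr (Nat.lt_succ_self k))
  refine ⟨lev, hlev_le, hmem, fun i hi => ?_⟩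
  rcases Nat.eq_zero_or_pos i with rfl | h0
  · obtain ⟨v, hv⟩ := hne
    exact ⟨v, Nat.le_zero.1 ((hmem 0 (by omega) v).1 hv)⟩
  rcases Nat.lt_or_ge k i with hk | hk
  · obtain ⟨v, -, hv⟩ := exists_of_ssubset htop
    rw [hmem k le_rfl] at hv
    have := hlev_le v
    exact ⟨v, by omega⟩
  · obtain ⟨v, hv, hv'⟩ := exists_of_ssubset (hchain (i - 1) (by omega))
    rw [Nat.sub_add_cancel h0, hmem i hk] at hv
    rw [hmem (i - 1) (by omega)] at hv'
    exact ⟨v, by omega⟩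

variable {G : SimpleGraph V} {Vc : ℕ → Finset V} {k : ℕ} {x : Sym2 V → ℝ} {lev : V → ℕ}

lemma IsLevelMap.level_eq (hl : IsLevelMap Vc k lev) {i : ℕ} (hi : 1 ≤ i) (hik : i ≤ k) :
    level Vc k i = univ.filter fun v => lev v = i := by
  ext v
  simp only [level, if_neg (show ¬ i = 0 by omega), if_pos hik, mem_sdiff, mem_filter, mem_univ,
    true_and, hl.mem_iff i hik, hl.mem_iff (i - 1) (by omega)]
  omega

lemma IsLevelMap.sum_cut (hl : IsLevelMap Vc k lev) (hx : x ∈ spanningTreePolytope G) {i : ℕ}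
    (hi : i ≤ k) : ∑ e ∈ cut G (Vc i), x e =
      pairSum (fun u v => x s(u, v)) (fun u v => lev u ≤ i ∧ i < lev v) := by
  rw [_root_.sum_cut_s12 hx]
  exact pairSum_congr fun u v => by rw [hl.mem_iff i hi, hl.mem_iff i hi]; omega

lemma sum_cut_singleton (hx : x ∈ spanningTreePolytope G) (S : Finset V) :
    ∑ v ∈ S, ∑ e ∈ cut G {v}, x e = pairSum (fun u v => x s(u, v)) (fun u _ => u ∈ S) := by
  have h (v : V) : ∑ e ∈ cut G {v}, x e = ∑ u, x s(v, u) := by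
    rw [sum_cut_s12 hx, pairSum, sum_eq_single v]
    · refine sum_congr rfl fun u _ => ?_
      by_cases hu : u = v
      · subst hu
        simp [spanningTreePolytope_eq_zero hx (e := s(u, u)) (by simp)]
      · simp [hu]
    · intro u _ hu
      simp [hu]
    · simp
  simp only [h, pairSum]
  have h' (f : V → ℝ) : ∑ u ∈ S, f u = ∑ u, if u ∈ S then f u else 0 := by simp
  rw [h']
  refine sum_congr rfl fun u _ => ?_
  by_cases hu : u ∈ S <;> simp [hu]

lemma IsChainPoint.isChainWeight [Nonempty V] (hx : IsChainPoint G Vc k x)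
    (hl : IsLevelMap Vc k lev) {lam : ℝ} (h0 : 0 ≤ lam) (h1 : lam ≤ 1)
    (hlam : ∀ i ≤ k, ∑ e ∈ cut G (Vc i), x e ≤ 2 - lam) :
    IsChainWeight (fun u v => x s(u, v)) lev k lam := by
  obtain ⟨hx, hbot, htop, -, hdeg⟩ := hx
  rw [hl.sum_cut hx (by omega)] at hbot htop
  have hdeg' (i : ℕ) (hi : 1 ≤ i) (hik : i ≤ k) :
      pairSum (fun u v => x s(u, v)) (fun u _ => lev u = i) =
        2 * ((univ.filter fun v => lev v = i).card : ℝ) := by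
    rw [← hl.level_eq hi hik, ← hdeg i hi hik, sum_cut_singleton hx]
    simp [hl.level_eq hi hik]
  have hsymm (u v : V) : x s(u, v) = x s(v, u) := by rw [Sym2.eq_swap]
  have hmid (j : ℕ) (hj : j ≤ k) :
      pairSum (fun u v => x s(u, v)) (fun u _ => 1 ≤ lev u ∧ lev u ≤ j) =
        2 * ((univ.filter fun v => 1 ≤ lev v ∧ lev v ≤ j).card : ℝ) := by
    induction j with
    | zero =>
      have (v : V) : ¬ (1 ≤ lev v ∧ lev v ≤ 0) := by omega
      simp only [pairSum, this]
      simp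
    | succ j ih =>
      have e (v : V) : 1 ≤ lev v ∧ lev v ≤ j + 1 ↔ (1 ≤ lev v ∧ lev v ≤ j) ∨ lev v = j + 1 := by
        omega
      simp only [e]
      rw [pairSum_or (fun u v => by omega), ih (by omega), hdeg' (j + 1) (by omega) hj, filter_or,
        card_union_of_disjoint]
      · push_cast; ring
      · rw [disjoint_filter]; intro v _; omega
  have hsub (i : ℕ) (hi : i ≤ k + 1) :
      pairSum (fun u v => x s(u, v)) (fun u v => lev u = i ∧ lev v = i) ≤
        2 * (((univ.filter fun v => lev v = i).card : ℝ) - 1) := by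
    obtain ⟨v, hv⟩ := hl.surj i hi
    have := spanningTreePolytope_sum_mem_le hx (S := univ.filter fun v => lev v = i)
      ⟨v, by simp [hv]⟩
    rw [← pairSum_mem (w := fun u v => x s(u, v))] at this
    simpa using this
  have htot := spanningTreePolytope_sum hx
  have hT : ∑ u, ∑ v, x s(u, v) = pairSum (fun u v => x s(u, v)) (fun u _ => lev u = 0) +
      (pairSum (fun u v => x s(u, v)) (fun u _ => 1 ≤ lev u ∧ lev u ≤ k) +
        pairSum (fun u v => x s(u, v)) (fun u _ => lev u = k + 1)) := by
    rw [← pairSum_or (fun u v => by omega), ← pairSum_or (fun u v => by omega)]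
    have (u : V) : lev u = 0 ∨ 1 ≤ lev u ∧ lev u ≤ k ∨ lev u = k + 1 := by
      have := hl.lev_le u; omega
    simp [pairSum, this]
  have hC : (Fintype.card V : ℝ) = (univ.filter fun v => lev v = 0).card +
      ((univ.filter fun v => 1 ≤ lev v ∧ lev v ≤ k).card +
        (univ.filter fun v => lev v = k + 1).card) := by
    rw [← card_univ]
    norm_cast
    rw [← card_union_of_disjoint, ← card_union_of_disjoint]
    · congr 1
      ext v
      have := hl.lev_le v
      simp
      omega
    · rw [← filter_or, disjoint_filter]; intro v _; omega
    · rw [disjoint_filter]; intro v _; omega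
  have hm := hmid k le_rfl
  have hb : pairSum (fun u v => x s(u, v)) (fun u _ => lev u = 0) =
      pairSum (fun u v => x s(u, v)) (fun u v => lev u = 0 ∧ lev v = 0) + 1 := by
    rw [← hbot]
    exact pairSum_split (fun u v => by omega) (fun u v => by omega)
  have ht : pairSum (fun u v => x s(u, v)) (fun u _ => lev u = k + 1) =
      pairSum (fun u v => x s(u, v)) (fun u v => lev u = k + 1 ∧ lev v = k + 1) + 1 := by
    rw [← htop, pairSum_comm hsymm (fun u v => lev u ≤ k ∧ k < lev v)]
    refine pairSum_split (fun u v => ?_) (fun u v => by omega)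
    have := hl.lev_le u
    have := hl.lev_le v
    omega
  have hs0 := hsub 0 (by omega)
  have hs1 := hsub (k + 1) le_rfl
  refine ⟨hsymm, fun u v => spanningTreePolytope_nonneg hx _,
    fun S hS => spanningTreePolytope_sum_mem_le hx hS, hl.lev_le, hl.surj, hdeg', ?_, ?_,
    fun i hi => ?_, hbot.le, htop.le, h0, h1⟩
  · linarith
  · linarith
  · rw [← hl.sum_cut hx hi]
    exact hlam i hi

end levels

section gaoTrees

section graphs

/-- A graph in which the classes of a labelling are connected has many edges. -/
lemma SimpleGraph.card_le_card_edgeFinset_add_card_image [Nonempty V] {H : SimpleGraph V}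
    {Q : V → V} (hQ : ∀ u v, Q u = Q v → H.Reachable u v) :
    Fintype.card V ≤ H.edgeFinset.card + (univ.image Q).card := by
  set ρ : V → V := fun y => Function.invFun Q y with hρ
  have hρQ (v : V) : H.Reachable (ρ (Q v)) v := hQ _ _ (Function.invFun_eq ⟨v, rfl⟩)
  obtain ⟨v₀⟩ := ‹Nonempty V›
  set E : Finset (Sym2 V) := ((univ.image Q).erase (Q v₀)).image fun y => s(ρ (Q v₀), ρ y) with hE
  have hconn : (H ⊔ SimpleGraph.fromEdgeSet (E : Set (Sym2 V))).Connected := by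
    rw [SimpleGraph.connected_iff_exists_forall_reachable]
    refine ⟨ρ (Q v₀), fun v => SimpleGraph.Reachable.trans ?_ ((hρQ v).mono le_sup_left)⟩
    by_cases hv : ρ (Q v₀) = ρ (Q v)
    · rw [hv]
    · refine SimpleGraph.Adj.reachable (Or.inr ?_)
      rw [SimpleGraph.fromEdgeSet_adj]
      refine ⟨mem_coe.2 (mem_image.2 ⟨Q v, mem_erase.2 ⟨fun h => hv (by rw [h]), ?_⟩, rfl⟩), hv⟩
      exact mem_image_of_mem Q (mem_univ v)
  have h1 := hconn.card_vert_le_card_edgeSet_add_one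
  have h2 : (H ⊔ SimpleGraph.fromEdgeSet (E : Set (Sym2 V))).edgeSet ⊆ ↑(H.edgeFinset ∪ E) := by
    rw [SimpleGraph.edgeSet_sup, SimpleGraph.edgeSet_fromEdgeSet]
    intro e he
    simp only [coe_union, SimpleGraph.coe_edgeFinset]
    exact he.imp id And.left
  have h3 := Set.ncard_le_ncard h2 (finite_toSet _)
  rw [Set.ncard_coe_finset] at h3
  have h4 := card_union_le H.edgeFinset E
  have h5 : E.card + 1 ≤ (univ.image Q).card := by
    rw [← card_erase_add_one (mem_image_of_mem Q (mem_univ v₀))]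
    exact Nat.succ_le_succ card_image_le
  rw [Nat.card_eq_fintype_card, Nat.card_coe_set_eq] at h1
  omega

omit [Fintype V] in
lemma SimpleGraph.Connected.exists_adj_of_mem_of_notMem {H : SimpleGraph V} (hH : H.Connected)
    {S : Set V} {a b : V} (ha : a ∈ S) (hb : b ∉ S) : ∃ u v, H.Adj u v ∧ u ∈ S ∧ v ∉ S := by
  obtain ⟨p⟩ := hH.preconnected a b
  obtain ⟨d, -, hd⟩ := p.exists_boundary_dart S ha hb
  exact ⟨d.fst, d.snd, d.adj, hd⟩

variable {G : SimpleGraph V}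

lemma SimpleGraph.IsTree.isSpanningTree {T : SimpleGraph V} (hT : T.IsTree) (hTG : T ≤ G) :
    IsSpanningTree G T.edgeFinset := by
  refine ⟨by simpa using hTG, ?_⟩
  rw [SimpleGraph.coe_edgeFinset, SimpleGraph.fromEdgeSet_edgeSet]
  exact hT

lemma le_cycleRank {T X : Finset (Sym2 V)} (hT : IsSpanningTree G T) :
    (T ∩ X).card ≤ cycleRank G X := by
  refine le_sup (f := fun T => (T ∩ X).card) (mem_filter.2 ⟨mem_powerset.2 fun e he => ?_, hT⟩)
  exact SimpleGraph.mem_edgeFinset.2 (hT.1 (mem_coe.2 he))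

lemma le_gaoRank {Vc : ℕ → Finset V} {k : ℕ} {T X : Finset (Sym2 V)} (hT : IsGaoTree G Vc k T) :
    (T ∩ X).card ≤ gaoRank G Vc k X := by
  refine le_sup (f := fun T => (T ∩ X).card) (mem_filter.2 ⟨mem_powerset.2 fun e he => ?_, hT⟩)
  exact SimpleGraph.mem_edgeFinset.2 (hT.1.1 (mem_coe.2 he))

/-- The rank of `X` is at least the number of vertices minus the number of components of `X`. -/
lemma card_le_cycleRank_add (hG : G.Connected) {X : Finset (Sym2 V)}
    (hX : (X : Set (Sym2 V)) ⊆ G.edgeSet) {Q : V → V}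
    (hQ : ∀ u v, Q u = Q v → (SimpleGraph.fromEdgeSet (X : Set (Sym2 V))).Reachable u v) :
    Fintype.card V ≤ cycleRank G X + (univ.image Q).card := by
  have := hG.nonempty
  obtain ⟨H, hH, hHa, hHr⟩ :=
    (SimpleGraph.fromEdgeSet (X : Set (Sym2 V))).exists_isAcyclic_reachable_eq_le
  have hXG : SimpleGraph.fromEdgeSet (X : Set (Sym2 V)) ≤ G := by
    intro u v huv
    exact hX ((SimpleGraph.fromEdgeSet_adj _).1 huv).1
  obtain ⟨T, hHT, hTG, hT⟩ := hG.exists_isTree_le_of_le_of_isAcyclic (hH.trans hXG) hHa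
  have h1 := SimpleGraph.card_le_card_edgeFinset_add_card_image (H := H) (Q := Q)
    fun u v huv => by rw [hHr]; exact hQ u v huv
  have h2 := le_cycleRank (X := X) (hT.isSpanningTree hTG)
  have h3 : H.edgeFinset ⊆ T.edgeFinset ∩ X := by
    intro e he
    rw [SimpleGraph.mem_edgeFinset] at he
    refine mem_inter.2 ⟨SimpleGraph.mem_edgeFinset.2 (SimpleGraph.edgeSet_mono hHT he), ?_⟩
    have := SimpleGraph.edgeSet_mono hH he
    rw [SimpleGraph.edgeSet_fromEdgeSet] at this
    exact mem_coe.1 this.1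
  have h4 := card_le_card h3
  omega

end graphs

variable {G : SimpleGraph V} {Vc : ℕ → Finset V} {k : ℕ} {lev : V → ℕ} {w : V → V → ℝ} {lam : ℝ}

/-- One or two consecutive levels cannot be split without cutting a positive weight. -/
lemma IsChainWeight.exists_ne_zero (h : IsChainWeight w lev k lam) (hlam : 0 < lam) {a b : ℕ}
    (hab : a ≤ b) (hba : b ≤ a + 1) (hb : b ≤ k + 1) {A B : Finset V} (hA : A.Nonempty)
    (hB : B.Nonempty) (hd : Disjoint A B) (hAB : ∀ v, v ∈ A ∨ v ∈ B ↔ a ≤ lev v ∧ lev v ≤ b) :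
    ∃ u ∈ A, ∃ v ∈ B, w u v ≠ 0 := by
  by_contra! h0
  have h1 := h.le_pairSum_interval hab hba hb
  have h2 : (univ.filter fun v => a ≤ lev v ∧ lev v ≤ b).card = A.card + B.card := by
    rw [← card_union_of_disjoint hd]
    congr 1
    ext v
    simp [hAB v]
  have h3 : pairSum w (fun u v => (a ≤ lev u ∧ lev u ≤ b) ∧ (a ≤ lev v ∧ lev v ≤ b)) ≤
      pairSum w (fun u v => u ∈ A ∧ v ∈ A) + pairSum w (fun u v => u ∈ B ∧ v ∈ B) := by
    simp only [pairSum, ← sum_add_distrib]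
    refine sum_le_sum fun u _ => sum_le_sum fun v _ => ?_
    have p0 := h.nonneg u v
    by_cases hP : (a ≤ lev u ∧ lev u ≤ b) ∧ (a ≤ lev v ∧ lev v ≤ b)
    · rw [if_pos hP]
      rcases (hAB u).2 hP.1 with hu | hu <;> rcases (hAB v).2 hP.2 with hv | hv
      · rw [if_pos ⟨hu, hv⟩]
        split_ifs <;> linarith
      · rw [h0 u hu v hv]
        split_ifs <;> norm_num
      · rw [h.symm, h0 v hv u hu]
        split_ifs <;> norm_num
      · rw [if_pos (c := u ∈ B ∧ v ∈ B) ⟨hu, hv⟩]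
        split_ifs <;> linarith
    · rw [if_neg hP]
      split_ifs <;> linarith
  rw [pairSum_mem, pairSum_mem] at h3
  have h4 := h.sparse A hA
  have h5 := h.sparse B hB
  rw [h2] at h1
  push_cast at h1
  linarith

/-- The edges of a graph within the levels. -/
def levelSubgraph (H : SimpleGraph V) (lev : V → ℕ) : SimpleGraph V where
  Adj u v := H.Adj u v ∧ lev u = lev v
  symm := ⟨fun _ _ h => ⟨h.1.symm, h.2.symm⟩⟩
  loopless := ⟨fun _ h => h.1.ne rfl⟩

omit [Fintype V] in
lemma levelSubgraph_le (H : SimpleGraph V) (lev : V → ℕ) : levelSubgraph H lev ≤ H :=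
  fun _ _ h => h.1

omit [Fintype V] in
lemma lev_eq_of_reachable {H : SimpleGraph V} {u v : V}
    (h : (levelSubgraph H lev).Reachable u v) : lev u = lev v := by
  obtain ⟨p⟩ := h
  induction p with
  | nil => rfl
  | cons h _ ih => exact h.2.trans ih

lemma IsChainWeight.reachable (h : IsChainWeight w lev k lam) (hlam : 0 < lam)
    (hw : ∀ u v, w u v ≠ 0 → G.Adj u v) {u v : V} (huv : lev u = lev v) :
    (levelSubgraph G lev).Reachable u v := by
  by_contra hv
  obtain ⟨a, ha, b, hb, hab⟩ := h.exists_ne_zero hlam le_rfl (Nat.le_succ _) (h.lev_le u)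
    (A := univ.filter fun v => lev v = lev u ∧ (levelSubgraph G lev).Reachable u v)
    (B := univ.filter fun v => lev v = lev u ∧ ¬ (levelSubgraph G lev).Reachable u v)
    ⟨u, by simp⟩ ⟨v, by simp [huv, hv]⟩ (by rw [disjoint_filter]; tauto)
    (fun v => by simp only [mem_filter, mem_univ, true_and]; grind)
  simp only [mem_filter, mem_univ, true_and] at ha hb
  exact hb.2 (ha.2.trans (SimpleGraph.Adj.reachable ⟨hw a b hab, ha.1.trans hb.1.symm⟩))

lemma IsChainWeight.exists_adj_succ (h : IsChainWeight w lev k lam) (hlam : 0 < lam)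
    (hw : ∀ u v, w u v ≠ 0 → G.Adj u v) {i : ℕ} (hi : i ≤ k) :
    ∃ u v, G.Adj u v ∧ lev u = i ∧ lev v = i + 1 := by
  obtain ⟨u, hu⟩ := h.lev_surj i (by omega)
  obtain ⟨v, hv⟩ := h.lev_surj (i + 1) (by omega)
  obtain ⟨a, ha, b, hb, hab⟩ := h.exists_ne_zero hlam (Nat.le_succ i) le_rfl (by omega)
    (A := univ.filter fun v => lev v = i) (B := univ.filter fun v => lev v = i + 1)
    ⟨u, by simp [hu]⟩ ⟨v, by simp [hv]⟩ (by rw [disjoint_filter]; intro v _; omega)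
    (fun v => by simp only [mem_filter, mem_univ, true_and]; omega)
  simp only [mem_filter, mem_univ, true_and] at ha hb
  exact ⟨a, b, hw a b hab, ha, hb⟩

/-- A lower bound for the rank of `X` in the matroid of Gao-trees. -/
lemma card_add_card_le_gaoRank_add (hl : IsLevelMap Vc k lev) (h : IsChainWeight w lev k lam)
    (hlam : 0 < lam) (hw : ∀ u v, w u v ≠ 0 → G.Adj u v) {X : Finset (Sym2 V)}
    (hX : (X : Set (Sym2 V)) ⊆ G.edgeSet) {K : V → V} {F : Finset ℕ} (hF : F ⊆ range (k + 1))
    (hK : ∀ u v, K u = K v →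
      (levelSubgraph (SimpleGraph.fromEdgeSet (X : Set (Sym2 V))) lev).Reachable u v)
    (hFX : ∀ i ∈ F, ∃ u v, lev u = i ∧ lev v = i + 1 ∧ s(u, v) ∈ X) :
    Fintype.card V + F.card ≤ gaoRank G Vc k X + (univ.image K).card := by
  have hd (i : ℕ) (hi : i ≤ k) : ∃ p : V × V, G.Adj p.1 p.2 ∧ lev p.1 = i ∧ lev p.2 = i + 1 ∧
      (i ∈ F → s(p.1, p.2) ∈ X) := by
    by_cases hiF : i ∈ F
    · obtain ⟨u, v, hu, hv, huv⟩ := hFX i hiF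
      exact ⟨(u, v), hX (mem_coe.2 huv), hu, hv, fun _ => huv⟩
    · obtain ⟨u, v, huv, hu, hv⟩ := h.exists_adj_succ hlam hw hi
      exact ⟨(u, v), huv, hu, hv, fun hiF' => absurd hiF' hiF⟩
  obtain ⟨v₀, hv₀⟩ := h.lev_surj 0 (by omega)
  obtain ⟨v₁, hv₁⟩ := h.lev_surj (k + 1) le_rfl
  have : Nonempty V := ⟨v₀⟩
  choose! d hdG hd₁ hd₂ hdX using hd
  set E : Set (Sym2 V) := {e | ∃ i ≤ k, e = s((d i).1, (d i).2)} with hE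
  set H := levelSubgraph G lev ⊔ SimpleGraph.fromEdgeSet E with hH
  have hHG : H ≤ G := by
    refine sup_le (levelSubgraph_le G lev) fun u v huv => ?_
    obtain ⟨i, hi, he⟩ := ((SimpleGraph.fromEdgeSet_adj _).1 huv).1
    rw [← SimpleGraph.mem_edgeSet, he]
    exact hdG i hi
  have hHc : H.Connected := by
    rw [SimpleGraph.connected_iff_exists_forall_reachable]
    refine ⟨v₀, fun v => ?_⟩
    induction hn : lev v generalizing v with
    | zero => exact (h.reachable hlam hw (hv₀.trans hn.symm)).mono le_sup_left
    | succ i ih =>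
      have hi : i ≤ k := by have := h.lev_le v; omega
      refine (ih _ (hd₁ i hi)).trans (SimpleGraph.Reachable.trans (v := (d i).2) ?_ ?_)
      · refine SimpleGraph.Adj.reachable (Or.inr ?_)
        exact (SimpleGraph.fromEdgeSet_adj _).2 ⟨⟨i, hi, rfl⟩, (hdG i hi).ne⟩
      · exact (h.reachable hlam hw ((hd₂ i hi).trans hn.symm)).mono le_sup_left
  have hXG : SimpleGraph.fromEdgeSet (X : Set (Sym2 V)) ≤ G := fun u v huv =>
    hX ((SimpleGraph.fromEdgeSet_adj _).1 huv).1
  obtain ⟨H₀, hH₀, hH₀a, hH₀r⟩ := (levelSubgraph (SimpleGraph.fromEdgeSet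
    (X : Set (Sym2 V))) lev).exists_isAcyclic_reachable_eq_le
  have hH₀H : H₀ ≤ H := fun u v huv => Or.inl ⟨hXG (hH₀ huv).1, (hH₀ huv).2⟩
  obtain ⟨T, hHT, hTH, hT⟩ := hHc.exists_isTree_le_of_le_of_isAcyclic hH₀H hH₀a
  have hcross {i : ℕ} {u v : V} (huv : T.Adj u v) (hu : lev u ≤ i) (hv : i < lev v) :
      s(u, v) = s((d i).1, (d i).2) := by
    rcases hTH huv with huv | huv
    · exact absurd huv.2 (by omega)
    · obtain ⟨j, hj, he⟩ := ((SimpleGraph.fromEdgeSet_adj _).1 huv).1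
      have h1 := hd₁ j hj
      have h2 := hd₂ j hj
      rcases Sym2.eq_iff.1 he with ⟨rfl, rfl⟩ | ⟨rfl, rfl⟩
      · obtain rfl : j = i := by omega
        exact he
      · omega
  have hdT {i : ℕ} (hi : i ≤ k) : s((d i).1, (d i).2) ∈ T.edgeSet := by
    obtain ⟨u, v, huv, hu, hv⟩ := hT.connected.exists_adj_of_mem_of_notMem
      (S := {v | lev v ≤ i}) (a := v₀) (b := v₁) (by simp [hv₀]) (by simp; omega)
    rw [← hcross huv hu (not_le.1 hv)]
    exact huv
  have hcut {i : ℕ} (hi : i ≤ k) : T.edgeFinset ∩ cut G (Vc i) = {s((d i).1, (d i).2)} := by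
    ext e
    simp only [mem_inter, SimpleGraph.mem_edgeFinset, mem_cut, mem_singleton, hl.mem_iff i hi]
    constructor
    · rintro ⟨he, u, v, rfl, -, hu, hv⟩
      exact hcross he hu (not_le.1 hv)
    · rintro rfl
      exact ⟨hdT hi, _, _, rfl, hdG i hi, (hd₁ i hi).le, by rw [hd₂ i hi]; omega⟩
  have hgao : IsGaoTree G Vc k T.edgeFinset :=
    ⟨hT.isSpanningTree (hTH.trans hHG), fun i hi => by rw [hcut hi, card_singleton]⟩
  have hFk {i : ℕ} (hi : i ∈ F) : i ≤ k := Nat.lt_succ_iff.1 (mem_range.1 (hF hi))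
  have h1 : H₀.edgeFinset ∪ F.image (fun i => s((d i).1, (d i).2)) ⊆ T.edgeFinset ∩ X := by
    refine union_subset (fun e he => ?_) fun e he => ?_
    · rw [SimpleGraph.mem_edgeFinset] at he
      refine mem_inter.2 ⟨SimpleGraph.mem_edgeFinset.2 (SimpleGraph.edgeSet_mono hHT he), ?_⟩
      have := SimpleGraph.edgeSet_mono (hH₀.trans (levelSubgraph_le _ lev)) he
      rw [SimpleGraph.edgeSet_fromEdgeSet] at this
      exact mem_coe.1 this.1
    · obtain ⟨i, hi, rfl⟩ := mem_image.1 he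
      exact mem_inter.2 ⟨SimpleGraph.mem_edgeFinset.2 (hdT (hFk hi)), hdX i (hFk hi) hi⟩
  have h2 := (card_le_card h1).trans (le_gaoRank hgao)
  rw [card_union_of_disjoint, card_image_of_injOn] at h2
  · have h3 := SimpleGraph.card_le_card_edgeFinset_add_card_image (H := H₀) (Q := K)
      fun u v huv => by rw [hH₀r]; exact hK u v huv
    omega
  · intro i hi j hj hij
    have := hd₁ i (hFk hi)
    have := hd₁ j (hFk hj)
    have := hd₂ i (hFk hi)
    have := hd₂ j (hFk hj)
    rcases Sym2.eq_iff.1 hij with ⟨e1, e2⟩ | ⟨e1, e2⟩ <;>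
    · replace e1 := congrArg lev e1
      replace e2 := congrArg lev e2
      omega
  · rw [disjoint_right]
    intro e he he'
    obtain ⟨i, hi, rfl⟩ := mem_image.1 he
    rw [SimpleGraph.mem_edgeFinset] at he'
    have h3 := (hH₀ he').2
    rw [hd₁ i (hFk hi), hd₂ i (hFk hi)] at h3
    omega

end gaoTrees

/-- A labelling of the vertices whose classes are the connected components. -/
noncomputable def componentRep (H : SimpleGraph V) (v : V) : V :=
  Quot.out (H.connectedComponentMk v)

omit [Fintype V] in
lemma componentRep_eq_iff {H : SimpleGraph V} {u v : V} :
    componentRep H u = componentRep H v ↔ H.Reachable u v := by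
  rw [← SimpleGraph.ConnectedComponent.eq]
  refine ⟨fun h => ?_, fun h => by rw [componentRep, h, componentRep]⟩
  rw [← Quot.out_eq (H.connectedComponentMk u), ← Quot.out_eq (H.connectedComponentMk v)]
  exact congrArg (Quot.mk _) h

lemma covered_componentRep {G : SimpleGraph V} {X : Finset (Sym2 V)}
    (hX : (X : Set (Sym2 V)) ⊆ G.edgeSet) {lev : V → ℕ} {k : ℕ} (hlev : ∀ v, lev v ≤ k + 1)
    {u v : V} (huv : s(u, v) ∈ X) :
    Covered lev
      (componentRep (levelSubgraph (SimpleGraph.fromEdgeSet (X : Set (Sym2 V))) lev))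
      (componentRep (SimpleGraph.fromEdgeSet (X : Set (Sym2 V))))
      ((range (k + 1)).filter fun i => ∃ u v, lev u = i ∧ lev v = i + 1 ∧ s(u, v) ∈ X) u v := by
  have hne : u ≠ v := (hX (mem_coe.2 huv) : G.Adj u v).ne
  have hadj : (SimpleGraph.fromEdgeSet (X : Set (Sym2 V))).Adj u v :=
    (SimpleGraph.fromEdgeSet_adj _).2 ⟨mem_coe.2 huv, hne⟩
  by_cases h : lev u = lev v
  · exact Or.inl (componentRep_eq_iff.2 (SimpleGraph.Adj.reachable ⟨hadj, h⟩))
  · refine Or.inr ⟨componentRep_eq_iff.2 hadj.reachable, ?_⟩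
    have h1 := hlev u
    have h2 := hlev v
    have h3 (h3 : lev v = lev u + 1) : lev u ∈ (range (k + 1)).filter fun i =>
        ∃ u v, lev u = i ∧ lev v = i + 1 ∧ s(u, v) ∈ X :=
      mem_filter.2 ⟨mem_range.2 (by omega), u, v, rfl, h3, huv⟩
    have h4 (h4 : lev u = lev v + 1) : lev v ∈ (range (k + 1)).filter fun i =>
        ∃ u v, lev u = i ∧ lev v = i + 1 ∧ s(u, v) ∈ X :=
      mem_filter.2 ⟨mem_range.2 (by omega), v, u, rfl, h4, Sym2.eq_swap ▸ huv⟩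
    rcases Nat.lt_or_gt_of_ne h with h | h
    · rcases Nat.eq_or_lt_of_le h with h | h
      · exact Or.inr (Or.inr (Or.inl ⟨h.symm, h3 h.symm⟩))
      · exact Or.inl h
    · rcases Nat.eq_or_lt_of_le h with h | h
      · exact Or.inr (Or.inr (Or.inr ⟨h.symm, h4 h.symm⟩))
      · exact Or.inr (Or.inl h)

theorem stmt12 (G : SimpleGraph V) (hG : G.Connected)
    (Vc : ℕ → Finset V) (k : ℕ)
    (hne : (Vc 0).Nonempty) (hchain : ∀ i < k, Vc i ⊂ Vc (i + 1))
    (htop : Vc k ⊂ Finset.univ)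
    (x : Sym2 V → ℝ) (hx : IsChainPoint G Vc k x)
    (lam : ℝ)
    (hlam : lam = 2 - (Finset.range (k + 1)).sup'
      (Finset.nonempty_range_iff.mpr (Nat.succ_ne_zero k))
      (fun i => ∑ e ∈ cut G (Vc i), x e)) :
    ∀ X : Finset (Sym2 V), (X : Set (Sym2 V)) ⊆ G.edgeSet →
      lam * (gaoRank G Vc k X : ℝ) + (1 - lam) * (cycleRank G X : ℝ) ≥
        ∑ e ∈ X, x e := by
  intro X hX
  have := hG.nonempty
  obtain ⟨lev, hl⟩ := exists_isLevelMap hne hchain htop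
  have hcut : ∀ i ≤ k, ∑ e ∈ cut G (Vc i), x e ≤ 2 - lam := fun i hi => by
    have := le_sup' (fun i => ∑ e ∈ cut G (Vc i), x e) (mem_range.2 (Nat.lt_succ_of_le hi))
    linarith
  have hlam1 : lam ≤ 1 := by
    have := hcut 0 (Nat.zero_le k)
    rw [hx.2.1] at this
    linarith
  have hlam0 : 0 < lam := by
    rw [hlam, sub_pos, sup'_lt_iff]
    intro i hi
    have hi := Nat.lt_succ_iff.1 (mem_range.1 hi)
    rcases Nat.eq_zero_or_pos i with rfl | h0
    · rw [hx.2.1]; norm_num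
    rcases Nat.eq_or_lt_of_le hi with rfl | hk
    · rw [hx.2.2.1]; norm_num
    · exact hx.2.2.2.1 i h0 (by omega)
  have hW := hx.isChainWeight hl hlam0.le hlam1 hcut
  have hw (u v : V) (huv : x s(u, v) ≠ 0) : G.Adj u v := by
    by_contra h
    exact huv (spanningTreePolytope_eq_zero hx.1 h)
  set H := SimpleGraph.fromEdgeSet (X : Set (Sym2 V)) with hH
  have hF := filter_subset (fun i => ∃ u v, lev u = i ∧ lev v = i + 1 ∧ s(u, v) ∈ X) (range (k + 1))
  have hKQ : IsLevelRefinement lev (componentRep (levelSubgraph H lev)) (componentRep H) :=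
    ⟨fun u v h => lev_eq_of_reachable (componentRep_eq_iff.1 h),
      fun u v h => componentRep_eq_iff.2 ((componentRep_eq_iff.1 h).mono (levelSubgraph_le H lev))⟩
  have h1 := (two_mul_sum_edges (x := x) hX).trans_le
    ((pairSum_mono hW.nonneg fun u v huv => covered_componentRep hX hl.lev_le huv).trans
      (hW.rankBound hKQ hF))
  have h2 := card_add_card_le_gaoRank_add hl hW hlam0 hw hX hF
    (fun u v h => componentRep_eq_iff.1 h) fun i hi => (mem_filter.1 hi).2
  have h3 := card_le_cycleRank_add hG hX fun u v h => componentRep_eq_iff.1 h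
  rw [← Nat.cast_le (α := ℝ)] at h2 h3
  push_cast at h2 h3
  have h4 := mul_le_mul_of_nonneg_left h2 hlam0.le
  have h5 := mul_le_mul_of_nonneg_left h3 (sub_nonneg.2 hlam1)
  linarith
end
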